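/- arXiv:1908.01967 — 2 statements merged into one kernel-verified Lean document; each statement's English description precedes it below -/
import Mathlib

section
/- Fundamental theorem of mixed type surfaces: Let U ⊆ ℝ² be a connected, simply connected open set, let E, G : U → ℝ be smooth with E > 0, suppose there exists a point p ∈ U with G(p) = 0 and dG(p) ≠ 0 (a semidefinite point of the metric g = E du² + G dv² in L-coordinates), and let X, Y, Z : U → ℝ be smooth functions such that the Gauss–Codazzi equations (C1), (C2), (G) hold on U. Then there exist a smooth immersion f : U → 𝕃³ and a smooth map ψ : U → ℝ³ such that: ⟨f_u, f_u⟩ = E, ⟨f_u, f_v⟩ = 0, ⟨f_v, f_v⟩ = G; ⟨ψ, ψ⟩ = 0, ⟨ψ, f_u⟩ = 0, ⟨ψ, f_v⟩ = 1; and ⟨f_uu, ψ⟩ = X, ⟨f_uv, ψ⟩ = Y, ⟨f_vv, ψ⟩ = Z on U. Moreover, the pair (f, ψ) is unique up to isometries of 𝕃³: if (f̃, ψ̃) is another pair with the same properties, then there exist A ∈ O(1,2) and b ∈ ℝ³ such that f̃ = A·f + b and ψ̃ = A·ψ on U. -/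
noncomputable section

/-- The Minkowski inner product of signature (+,+,−) on ℝ³. -/
def mink (x y : Fin 3 → ℝ) : ℝ := x 0 * y 0 + x 1 * y 1 - x 2 * y 2

/-- The Lorentzian vector product `v × w = S (v ×ₑ w)`, `S = diag(1,1,−1)`. -/
def lcross (v w : Fin 3 → ℝ) : Fin 3 → ℝ :=
  ![v 1 * w 2 - v 2 * w 1, v 2 * w 0 - v 0 * w 2, -(v 0 * w 1 - v 1 * w 0)]

/-- Partial derivative in the first coordinate direction. -/
def pu {E : Type*} [NormedAddCommGroup E] [NormedSpace ℝ E]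
    (f : ℝ × ℝ → E) (q : ℝ × ℝ) : E :=
  fderiv ℝ f q (1, 0)

/-- Partial derivative in the second coordinate direction. -/
def pv {E : Type*} [NormedAddCommGroup E] [NormedSpace ℝ E]
    (f : ℝ × ℝ → E) (q : ℝ × ℝ) : E :=
  fderiv ℝ f q (0, 1)

section
open Set Filter Topology MeasureTheory

section
variable {R : Type*} [NormedRing R] [NormedAlgebra ℝ R] [CompleteSpace R]

theorem exists_volterra (A B : ℝ × ℝ → R) (hA : Continuous A) (hB : Continuous B)
    (a b r C : ℝ) (hr : 0 ≤ r)
    (bA : ∀ u v, |u - a| ≤ r → |v - b| ≤ r → ‖A (u, v)‖ ≤ C)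
    (bB : ∀ u v, |u - a| ≤ r → |v - b| ≤ r → ‖B (u, v)‖ ≤ C) (hrC : r * C ≤ 1 / 4) :
    ∃ F : ℝ × ℝ → R, Continuous F ∧ ∀ u v, |u - a| ≤ r → |v - b| ≤ r →
      F (u, v) = 1 + (∫ s in a..u, A (s, b) * F (s, b)) + ∫ t in b..v, B (u, t) * F (u, t) := by
  have hI : ∀ x : ℝ, x - r ≤ x + r := fun x => by linarith
  let c : ℝ × ℝ → (Icc (a - r) (a + r) × Icc (b - r) (b + r)) := fun p =>
    (projIcc _ _ (hI a) p.1, projIcc _ _ (hI b) p.2)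
  have hc : Continuous c :=
    (continuous_projIcc.comp continuous_fst).prodMk (continuous_projIcc.comp continuous_snd)
  have hC : 0 ≤ C := (norm_nonneg _).trans (bA a b (by simpa using hr) (by simpa using hr))
  let T : C(Icc (a - r) (a + r) × Icc (b - r) (b + r), R) →
      C(Icc (a - r) (a + r) × Icc (b - r) (b + r), R) := fun F =>
    ⟨fun p => 1 + (∫ s in a..p.1.1, A (s, b) * F (c (s, b)))
      + ∫ t in b..p.2.1, B (p.1.1, t) * F (c (p.1.1, t)), by
      refine (continuous_const.add ?_).add ?_
      · refine intervalIntegral.continuous_parametric_intervalIntegral_of_continuous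
          (f := fun (_ : (Icc (a - r) (a + r) × Icc (b - r) (b + r))) s =>
            A (s, b) * F (c (s, b))) ?_ (by fun_prop)
        simp only [Function.uncurry_def]; fun_prop
      · refine intervalIntegral.continuous_parametric_intervalIntegral_of_continuous
          (f := fun (p : (Icc (a - r) (a + r) × Icc (b - r) (b + r))) t =>
            B (p.1.1, t) * F (c (p.1.1, t))) ?_ (by fun_prop)
        simp only [Function.uncurry_def]; fun_prop⟩
  have habs : ∀ {x y : ℝ}, y ∈ Icc (x - r) (x + r) → |y - x| ≤ r := fun {x y} h => by
    rw [abs_le]; constructor <;> linarith [h.1, h.2]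
  have huIcc : ∀ {x y s : ℝ}, |y - x| ≤ r → s ∈ uIoc x y → |s - x| ≤ r := fun {x y s} h hs =>
    (abs_sub_left_of_mem_uIcc (uIoc_subset_uIcc hs)).trans h
  have hT : ContractingWith (1 / 2) T := by
    refine ⟨by norm_num, LipschitzWith.of_dist_le_mul fun F F' => ?_⟩
    rw [ContinuousMap.dist_le (by positivity)]
    intro p
    have hp1 := habs p.1.2
    have hp2 := habs p.2.2
    have hb0 : |b - b| ≤ r := by simpa using hr
    have key : ∀ x : (Icc (a - r) (a + r) × Icc (b - r) (b + r)),
        ‖F x - F' x‖ ≤ dist F F' := fun x => by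
      rw [← dist_eq_norm]; exact ContinuousMap.dist_apply_le_dist x
    have i1 : ∀ H : C(Icc (a - r) (a + r) × Icc (b - r) (b + r), R), IntervalIntegrable
        (fun s => A (s, b) * H (c (s, b))) volume a p.1.1 :=
      fun H => Continuous.intervalIntegrable (by fun_prop) _ _
    have i2 : ∀ H : C(Icc (a - r) (a + r) × Icc (b - r) (b + r), R), IntervalIntegrable
        (fun t => B (p.1.1, t) * H (c (p.1.1, t))) volume b p.2.1 :=
      fun H => Continuous.intervalIntegrable (by fun_prop) _ _
    have e : T F p - T F' p = (∫ s in a..p.1.1, A (s, b) * (F (c (s, b)) - F' (c (s, b))))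
        + ∫ t in b..p.2.1, B (p.1.1, t) * (F (c (p.1.1, t)) - F' (c (p.1.1, t))) := by
      simp only [mul_sub]
      rw [intervalIntegral.integral_sub (i1 F) (i1 F'),
        intervalIntegral.integral_sub (i2 F) (i2 F')]
      simp only [T, ContinuousMap.coe_mk]
      abel
    have n1 : ‖∫ s in a..p.1.1, A (s, b) * (F (c (s, b)) - F' (c (s, b)))‖
        ≤ C * dist F F' * |p.1.1 - a| :=
      intervalIntegral.norm_integral_le_of_norm_le_const fun s hs =>
        (norm_mul_le _ _).trans (mul_le_mul (bA _ _ (huIcc hp1 hs) hb0) (key _) (norm_nonneg _) hC)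
    have n2 : ‖∫ t in b..p.2.1, B (p.1.1, t) * (F (c (p.1.1, t)) - F' (c (p.1.1, t)))‖
        ≤ C * dist F F' * |p.2.1 - b| :=
      intervalIntegral.norm_integral_le_of_norm_le_const fun s hs =>
        (norm_mul_le _ _).trans (mul_le_mul (bB _ _ hp1 (huIcc hp2 hs)) (key _) (norm_nonneg _) hC)
    rw [dist_eq_norm, e]
    have hd : 0 ≤ dist F F' := dist_nonneg
    have hCd : 0 ≤ C * dist F F' := by positivity
    refine (norm_add_le _ _).trans ?_
    have : C * dist F F' * r ≤ 1 / 4 * dist F F' := by nlinarith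
    have := mul_le_mul_of_nonneg_left hp1 hCd
    have := mul_le_mul_of_nonneg_left hp2 hCd
    push_cast
    linarith
  let F := hT.fixedPoint T
  have hF : T F = F := hT.fixedPoint_isFixedPt
  refine ⟨fun p => F (c p), by fun_prop, fun u v hu hv => ?_⟩
  have hu' : u ∈ Icc (a - r) (a + r) := by
    rw [abs_le] at hu; constructor <;> linarith [hu.1, hu.2]
  have hv' : v ∈ Icc (b - r) (b + r) := by
    rw [abs_le] at hv; constructor <;> linarith [hv.1, hv.2]
  have : c (u, v) = (⟨u, hu'⟩, ⟨v, hv'⟩) := by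
    simp only [c, projIcc_of_mem _ hu', projIcc_of_mem _ hv']
  calc F (c (u, v)) = T F (c (u, v)) := by rw [hF]
    _ = _ := by rw [this]; simp only [T, ContinuousMap.coe_mk]

theorem hasDerivAt_pu {V : Type*} [NormedAddCommGroup V] [NormedSpace ℝ V] {f : ℝ × ℝ → V}
    {s t : ℝ} (h : DifferentiableAt ℝ f (s, t)) :
    HasDerivAt (fun x => f (x, t)) (pu f (s, t)) s :=
  h.hasFDerivAt.comp_hasDerivAt s ((hasDerivAt_id s).prodMk (hasDerivAt_const s t))

theorem hasDerivAt_pv {V : Type*} [NormedAddCommGroup V] [NormedSpace ℝ V] {f : ℝ × ℝ → V}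
    {s t : ℝ} (h : DifferentiableAt ℝ f (s, t)) :
    HasDerivAt (fun x => f (s, x)) (pv f (s, t)) t :=
  h.hasFDerivAt.comp_hasDerivAt t ((hasDerivAt_const t s).prodMk (hasDerivAt_id t))

theorem ContDiff.continuous_pu {V : Type*} [NormedAddCommGroup V] [NormedSpace ℝ V]
    {f : ℝ × ℝ → V} (hf : ContDiff ℝ 1 f) : Continuous (pu f) :=
  (hf.continuous_fderiv (by norm_num)).clm_apply continuous_const

theorem ContDiff.continuous_pv {V : Type*} [NormedAddCommGroup V] [NormedSpace ℝ V]
    {f : ℝ × ℝ → V} (hf : ContDiff ℝ 1 f) : Continuous (pv f) :=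
  (hf.continuous_fderiv (by norm_num)).clm_apply continuous_const

theorem volterra_eq_primitive_fst (A B F : ℝ × ℝ → R) (hA : ContDiff ℝ 1 A) (hB : ContDiff ℝ 1 B)
    (hF : Continuous F) (a b r C : ℝ) (hr : 0 ≤ r) (hr1 : r ≤ 1)
    (bB : ∀ u v, |u - a| ≤ r → |v - b| ≤ r → ‖B (u, v)‖ ≤ C)
    (bB' : ∀ u v, |u - a| ≤ r → |v - b| ≤ r → ‖pu B (u, v)‖ ≤ C) (hrC : r * C ≤ 1 / 4)
    (compat : ∀ u v, |u - a| ≤ r → |v - b| ≤ r →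
      pv A (u, v) + A (u, v) * B (u, v) = pu B (u, v) + B (u, v) * A (u, v))
    (hFeq : ∀ u v, |u - a| ≤ r → |v - b| ≤ r →
      F (u, v) = 1 + (∫ s in a..u, A (s, b) * F (s, b)) + ∫ t in b..v, B (u, t) * F (u, t))
    (u v : ℝ) (hu : |u - a| ≤ r) (hv : |v - b| ≤ r) :
    F (u, v) = F (a, v) + ∫ s in a..u, A (s, v) * F (s, v) := by
  have cA := hA.continuous
  have cB := hB.continuous
  have cA' := hA.continuous_pv
  have cB' := hB.continuous_pu
  have huIcc : ∀ {x y s : ℝ}, |y - x| ≤ r → s ∈ uIcc x y → |s - x| ≤ r := fun {x y s} h hs =>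
    (abs_sub_left_of_mem_uIcc hs).trans h
  have ha0 : |a - a| ≤ r := by simpa using hr
  have hb0 : |b - b| ≤ r := by simpa using hr
  let G : ℝ × ℝ → R := fun p =>
    1 + (∫ s in a..p.1, A (s, b) * F (s, b)) + ∫ t in b..p.2, B (p.1, t) * F (p.1, t)
  have dG : ∀ s t, HasDerivAt (fun t => G (s, t)) (B (s, t) * F (s, t)) t := fun s t =>
    ((show Continuous fun t => B (s, t) * F (s, t) by fun_prop).integral_hasStrictDerivAt
      b t).hasDerivAt.const_add (1 + ∫ x in a..s, A (x, b) * F (x, b))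
  have cI : Continuous fun p : ℝ × ℝ => ∫ s in a..p.1, A (s, p.2) * F (s, p.2) := by
    refine intervalIntegral.continuous_parametric_intervalIntegral_of_continuous
      (f := fun (p : ℝ × ℝ) s => A (s, p.2) * F (s, p.2)) ?_ (by fun_prop)
    simp only [Function.uncurry_def]; fun_prop
  let H : ℝ × ℝ → R := fun p => F (a, p.2) + ∫ s in a..p.1, A (s, p.2) * F (s, p.2)
  have cH : Continuous H := by fun_prop
  have dH : ∀ s t, HasDerivAt (fun s => H (s, t)) (A (s, t) * F (s, t)) s := fun s t =>
    ((show Continuous fun s => A (s, t) * F (s, t) by fun_prop).integral_hasStrictDerivAt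
      a s).hasDerivAt.const_add (F (a, t))
  have dA : ∀ s t, HasDerivAt (fun t => A (s, t)) (pv A (s, t)) t := fun s t =>
    hasDerivAt_pv (hA.differentiable (by norm_num) _)
  have dB : ∀ s t, HasDerivAt (fun s => B (s, t)) (pu B (s, t)) s := fun s t =>
    hasDerivAt_pu (hB.differentiable (by norm_num) _)
  let W : ℝ → ℝ → R := fun s t => pv A (s, t) * F (s, t) + A (s, t) * (B (s, t) * F (s, t))
  have cW : Continuous W.uncurry := by simp only [W, Function.uncurry_def]; fun_prop
  have e1 : ∀ s v, |s - a| ≤ r → |v - b| ≤ r →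
      ∫ t in b..v, W s t = A (s, v) * F (s, v) - A (s, b) * F (s, b) := by
    intro s v hs hv
    rw [hFeq s v hs hv, hFeq s b hs hb0]
    change _ = A (s, v) * G (s, v) - A (s, b) * G (s, b)
    rw [← intervalIntegral.integral_eq_sub_of_hasDerivAt (f := fun t => A (s, t) * G (s, t))
      (fun t _ => (dA s t).mul (dG s t))]
    · refine intervalIntegral.integral_congr fun t ht => ?_
      simp only [W]
      rw [show G (s, t) = F (s, t) from (hFeq s t hs (huIcc hv ht)).symm]
    · exact Continuous.intervalIntegrable
        ((by fun_prop : Continuous fun t => pv A (s, t)).mul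
          (continuous_iff_continuousAt.2 fun t => (dG s t).continuousAt) |>.add (by fun_prop)) _ _
  have e2 : ∀ u v, |u - a| ≤ r → |v - b| ≤ r →
      (∫ s in a..u, A (s, v) * F (s, v)) - ∫ s in a..u, A (s, b) * F (s, b)
        = ∫ t in b..v, ∫ s in a..u, W s t := by
    intro u v hu hv
    rw [← intervalIntegral.integral_sub (Continuous.intervalIntegrable (by fun_prop) _ _)
      (Continuous.intervalIntegrable (by fun_prop) _ _), ← intervalIntegral_intervalIntegral_swap]
    · exact intervalIntegral.integral_congr fun s hs => (e1 s v (huIcc hu hs) hv).symm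
    · exact (cW.continuousOn.integrableOn_compact (isCompact_uIcc.prod isCompact_uIcc)).mono_set
        (prod_mono uIoc_subset_uIcc uIoc_subset_uIcc)
  have e3 : ∀ u t, |u - a| ≤ r → |t - b| ≤ r →
      ∫ s in a..u, W s t = B (u, t) * H (u, t) - B (a, t) * F (a, t)
        + ∫ s in a..u, pu B (s, t) * (F (s, t) - H (s, t)) := by
    intro u t hu ht
    have : B (a, t) * F (a, t) = B (a, t) * H (a, t) := by simp [H]
    rw [this, ← intervalIntegral.integral_eq_sub_of_hasDerivAt
        (f := fun s => B (s, t) * H (s, t)) (fun s _ => (dB s t).mul (dH s t))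
        (Continuous.intervalIntegrable (by fun_prop) _ _),
      ← intervalIntegral.integral_add (Continuous.intervalIntegrable (by fun_prop) _ _)
        (Continuous.intervalIntegrable (by fun_prop) _ _)]
    refine intervalIntegral.integral_congr fun s hs => ?_
    have := compat s t (huIcc hu hs) ht
    simp only [W]
    rw [← mul_assoc, ← add_mul, this]
    noncomm_ring
  have e4 : ∀ u v, |u - a| ≤ r → |v - b| ≤ r → F (u, v) - H (u, v)
      = ∫ t in b..v, (B (u, t) * (F (u, t) - H (u, t))
          - ∫ s in a..u, pu B (s, t) * (F (s, t) - H (s, t))) := by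
    intro u v hu hv
    have cJ : Continuous fun t => ∫ s in a..u, W s t := by
      refine intervalIntegral.continuous_parametric_intervalIntegral_of_continuous
        (f := fun t s => W s t) ?_ (by fun_prop)
      exact cW.comp continuous_swap
    have h1 := hFeq u v hu hv
    have h2 := hFeq a v ha0 hv
    have h3 := e2 u v hu hv
    have : (∫ t in b..v, (B (u, t) * (F (u, t) - H (u, t))
          - ∫ s in a..u, pu B (s, t) * (F (s, t) - H (s, t))))
        = ∫ t in b..v, (B (u, t) * F (u, t) - B (a, t) * F (a, t) - ∫ s in a..u, W s t) := by
      refine intervalIntegral.integral_congr fun t ht => ?_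
      rw [e3 u t hu (huIcc hv ht)]
      noncomm_ring
    rw [this, intervalIntegral.integral_sub (Continuous.intervalIntegrable (by fun_prop) _ _)
        (cJ.intervalIntegrable _ _),
      intervalIntegral.integral_sub (Continuous.intervalIntegrable (by fun_prop) _ _)
      (Continuous.intervalIntegrable (by fun_prop) _ _), ← h3]
    simp only [H]
    rw [h1, h2]
    simp only [intervalIntegral.integral_same]
    abel
  obtain ⟨x, hx, hmax⟩ := ((isCompact_closedBall a r).prod
    (isCompact_closedBall b r)).exists_isMaxOn
    ⟨(a, b), Metric.mem_closedBall_self hr, Metric.mem_closedBall_self hr⟩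
    (hF.sub cH).norm.continuousOn
  have hM : ∀ u v, |u - a| ≤ r → |v - b| ≤ r →
      ‖F (u, v) - H (u, v)‖ ≤ ‖F x - H x‖ := fun u v hu hv =>
    hmax (show (u, v) ∈ _ from ⟨by simpa [Real.dist_eq] using hu, by simpa [Real.dist_eq] using hv⟩)
  have hx1 : |x.1 - a| ≤ r := by simpa [Real.dist_eq] using hx.1
  have hx2 : |x.2 - b| ≤ r := by simpa [Real.dist_eq] using hx.2
  have hC : 0 ≤ C := (norm_nonneg _).trans (bB a b ha0 hb0)
  set M := ‖F x - H x‖ with hMdef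
  have hM0 : 0 ≤ M := norm_nonneg _
  have hCM : 0 ≤ C * M := mul_nonneg hC hM0
  have hle : M ≤ 2 * (C * M) * |x.2 - b| := by
    rw [hMdef]
    conv_lhs => rw [show x = (x.1, x.2) from rfl, e4 x.1 x.2 hx1 hx2]
    refine intervalIntegral.norm_integral_le_of_norm_le_const fun t ht => ?_
    have ht' := huIcc hx2 (uIoc_subset_uIcc ht)
    have n1 : ‖B (x.1, t) * (F (x.1, t) - H (x.1, t))‖ ≤ C * M :=
      (norm_mul_le _ _).trans (mul_le_mul (bB _ _ hx1 ht') (hM _ _ hx1 ht') (norm_nonneg _) hC)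
    have n2 : ‖∫ s in a..x.1, pu B (s, t) * (F (s, t) - H (s, t))‖ ≤ C * M * |x.1 - a| := by
      refine intervalIntegral.norm_integral_le_of_norm_le_const fun s hs => ?_
      have hs' := huIcc hx1 (uIoc_subset_uIcc hs)
      exact (norm_mul_le _ _).trans
        (mul_le_mul (bB' _ _ hs' ht') (hM _ _ hs' ht') (norm_nonneg _) hC)
    refine (norm_sub_le _ _).trans ?_
    have := mul_le_mul_of_nonneg_left (hx1.trans hr1) hCM
    linarith
  have hM1 : M ≤ 0 := by
    have := mul_le_mul_of_nonneg_left hx2 hCM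
    nlinarith
  have := norm_le_zero_iff.1 ((hM u v hu hv).trans hM1)
  exact sub_eq_zero.1 this

end

section
variable {R : Type*} [NormedRing R] [NormedAlgebra ℝ R]

/-- `Φ` solves the linear system `Φ_u = A Φ`, `Φ_v = B Φ` on `s`. -/
def IsParallel (A B : ℝ × ℝ → R) (s : Set (ℝ × ℝ)) (Φ : ℝ × ℝ → R) : Prop :=
  ∀ q ∈ s, HasFDerivAt Φ ((ContinuousLinearMap.fst ℝ ℝ ℝ).smulRight (A q * Φ q)
    + (ContinuousLinearMap.snd ℝ ℝ ℝ).smulRight (B q * Φ q)) q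

theorem hasFDerivAt_of_partial {V : Type*} [NormedAddCommGroup V] [NormedSpace ℝ V]
    {f f₁ f₂ : ℝ × ℝ → V} {q : ℝ × ℝ}
    (h₁ : ∀ᶠ x in 𝓝 q, HasDerivAt (fun s => f (s, x.2)) (f₁ x) x.1)
    (h₂ : ∀ᶠ x in 𝓝 q, HasDerivAt (fun t => f (x.1, t)) (f₂ x) x.2)
    (c₁ : ContinuousAt f₁ q) (c₂ : ContinuousAt f₂ q) :
    HasFDerivAt f ((ContinuousLinearMap.fst ℝ ℝ ℝ).smulRight (f₁ q)
      + (ContinuousLinearMap.snd ℝ ℝ ℝ).smulRight (f₂ q)) q := by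
  have := (hasStrictFDerivAt_uncurry_coprod (𝕜 := ℝ) (u := q) (f := fun s t => f (s, t))
    (f₁ := fun s t => ContinuousLinearMap.toSpanSingleton ℝ (f₁ (s, t)))
    (f₂ := fun s t => ContinuousLinearMap.toSpanSingleton ℝ (f₂ (s, t)))
    (h₁.mono fun x hx => hx.hasFDerivAt) (h₂.mono fun x hx => hx.hasFDerivAt)
    ((ContinuousLinearMap.toSpanSingletonCLE
      (𝕜 := ℝ) (E := V)).continuous.continuousAt.comp c₁)
    ((ContinuousLinearMap.toSpanSingletonCLE
      (𝕜 := ℝ) (E := V)).continuous.continuousAt.comp c₂)).hasFDerivAt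
  refine this.congr_fderiv ?_
  ext <;> simp [Function.HasUncurry.uncurry]

theorem ContDiffOn.exists_contDiff_eqOn_ball {V : Type*} [NormedAddCommGroup V] [NormedSpace ℝ V]
    {f : ℝ × ℝ → V} {U : Set (ℝ × ℝ)} (hU : IsOpen U) (hf : ContDiffOn ℝ 1 f U) {x : ℝ × ℝ}
    {ρ : ℝ} (hρ : 0 < ρ) (hsub : Metric.closedBall x ρ ⊆ U) :
    ∃ g : ℝ × ℝ → V, ContDiff ℝ 1 g ∧ EqOn f g (Metric.ball x (ρ / 2)) := by
  let χ : ContDiffBump x := ⟨ρ / 2, ρ, by positivity, by linarith⟩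
  refine ⟨fun y => χ y • f y, contDiff_iff_contDiffAt.2 fun y => ?_, fun y hy => ?_⟩
  · by_cases hy : y ∈ U
    · exact χ.contDiff.contDiffAt.smul (hf.contDiffAt (hU.mem_nhds hy))
    · have : y ∉ tsupport χ := by rw [χ.tsupport_eq]; exact fun h => hy (hsub h)
      refine (contDiffAt_const (c := (0 : V))).congr_of_eventuallyEq ?_
      filter_upwards [notMem_tsupport_iff_eventuallyEq.1 this] with z hz
      simp [hz]
  · simp [χ.one_of_mem_closedBall (Metric.ball_subset_closedBall hy)]

theorem exists_isParallel_ball [CompleteSpace R] {A B : ℝ × ℝ → R} {U : Set (ℝ × ℝ)}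
    (hU : IsOpen U) (hA : ContDiffOn ℝ 1 A U) (hB : ContDiffOn ℝ 1 B U)
    (compat : ∀ q ∈ U, pv A q + A q * B q = pu B q + B q * A q) {x : ℝ × ℝ} (hx : x ∈ U) :
    ∃ r > 0, Metric.ball x r ⊆ U ∧ ∃ Φ : ℝ × ℝ → R, Φ x = 1 ∧
      IsParallel A B (Metric.ball x r) Φ := by
  obtain ⟨ρ, hρ, hsub⟩ := Metric.nhds_basis_closedBall.mem_iff.1 (hU.mem_nhds hx)
  obtain ⟨A', hA', eA⟩ := hA.exists_contDiff_eqOn_ball hU hρ hsub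
  obtain ⟨B', hB', eB⟩ := hB.exists_contDiff_eqOn_ball hU hρ hsub
  have hK := isCompact_closedBall x (1 : ℝ)
  obtain ⟨C₁, h₁⟩ := hK.exists_bound_of_continuousOn hA'.continuous.continuousOn
  obtain ⟨C₂, h₂⟩ := hK.exists_bound_of_continuousOn hB'.continuous.continuousOn
  obtain ⟨C₃, h₃⟩ := hK.exists_bound_of_continuousOn hB'.continuous_pu.continuousOn
  let C := |C₁| + |C₂| + |C₃| + 1
  have hC : 0 < C := by positivity
  let r := min 1 (min (ρ / 4) (1 / (4 * C)))
  have hr : 0 < r := by positivity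
  have hr1 : r ≤ 1 := min_le_left _ _
  have hrρ : r ≤ ρ / 4 := (min_le_right _ _).trans (min_le_left _ _)
  have hrC : r * C ≤ 1 / 4 := by
    have : r ≤ 1 / (4 * C) := (min_le_right _ _).trans (min_le_right _ _)
    rw [le_div_iff₀ (by positivity)] at this
    linarith
  obtain ⟨a, b⟩ := x
  have hball : ∀ {u v s : ℝ}, |u - a| ≤ s → |v - b| ≤ s → (u, v) ∈ Metric.closedBall (a, b) s :=
    fun hu hv => by simpa [Prod.dist_eq, Real.dist_eq] using ⟨hu, hv⟩
  have hball' : ∀ {u v : ℝ}, |u - a| ≤ r → |v - b| ≤ r → (u, v) ∈ Metric.ball (a, b) (ρ / 2) :=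
    fun hu hv => Metric.closedBall_subset_ball (by linarith) (hball hu hv)
  have hball1 : ∀ {u v : ℝ}, |u - a| ≤ r → |v - b| ≤ r → (u, v) ∈ Metric.closedBall (a, b) 1 :=
    fun hu hv => Metric.closedBall_subset_closedBall hr1 (hball hu hv)
  have hρU : Metric.ball (a, b) (ρ / 2) ⊆ U :=
    (Metric.ball_subset_closedBall.trans (Metric.closedBall_subset_closedBall (by linarith))).trans
      hsub
  have l1 : C₁ ≤ C := by
    have := le_abs_self C₁; have := abs_nonneg C₂; have := abs_nonneg C₃; simp only [C]; linarith
  have l2 : C₂ ≤ C := by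
    have := le_abs_self C₂; have := abs_nonneg C₁; have := abs_nonneg C₃; simp only [C]; linarith
  have l3 : C₃ ≤ C := by
    have := le_abs_self C₃; have := abs_nonneg C₁; have := abs_nonneg C₂; simp only [C]; linarith
  obtain ⟨F, hF, hFeq⟩ := exists_volterra A' B' hA'.continuous hB'.continuous a b r C hr.le
    (fun u v hu hv => (h₁ _ (hball1 hu hv)).trans l1)
    (fun u v hu hv => (h₂ _ (hball1 hu hv)).trans l2) hrC
  have cA := hA'.continuous
  have cB := hB'.continuous
  have hF1 := volterra_eq_primitive_fst A' B' F hA' hB' hF a b r C hr.le hr1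
    (fun u v hu hv => (h₂ _ (hball1 hu hv)).trans l2)
    (fun u v hu hv => (h₃ _ (hball1 hu hv)).trans l3) hrC
    (fun u v hu hv => by
      have hq := hball' hu hv
      have hn := Metric.isOpen_ball.mem_nhds hq
      have := compat _ (hρU hq)
      simp only [pu, pv] at this ⊢
      rwa [(eA.eventuallyEq_of_mem hn).fderiv_eq, (eB.eventuallyEq_of_mem hn).fderiv_eq,
        eA hq, eB hq] at this) hFeq
  refine ⟨r, hr, fun q hq => hρU (Metric.ball_subset_ball (by linarith) hq), F, ?_, ?_⟩
  · rw [hFeq a b (by simpa using hr.le) (by simpa using hr.le)]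
    simp
  intro q hq
  have hmem : ∀ y ∈ Metric.ball (a, b) r, |y.1 - a| < r ∧ |y.2 - b| < r := fun y hy => by
    simpa [Prod.dist_eq, Real.dist_eq] using hy
  have hqρ : q ∈ Metric.ball (a, b) (ρ / 2) := Metric.ball_subset_ball (by linarith) hq
  rw [eA hqρ, eB hqρ]
  refine hasFDerivAt_of_partial (f₁ := fun q => A' q * F q) (f₂ := fun q => B' q * F q)
    ?_ ?_ (by fun_prop) (by fun_prop)
  · filter_upwards [Metric.isOpen_ball.mem_nhds hq] with y hy
    obtain ⟨hy1, hy2⟩ := hmem y hy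
    refine (((show Continuous fun s => A' (s, y.2) * F (s, y.2) by
      fun_prop).integral_hasStrictDerivAt
      a y.1).hasDerivAt.const_add (F (a, y.2))).congr_of_eventuallyEq ?_
    filter_upwards [(by fun_prop : Continuous fun s : ℝ => |s - a|).continuousAt.eventually_lt
      continuousAt_const hy1] with s hs
    exact hF1 s y.2 hs.le hy2.le
  · filter_upwards [Metric.isOpen_ball.mem_nhds hq] with y hy
    obtain ⟨hy1, hy2⟩ := hmem y hy
    refine (((show Continuous fun t => B' (y.1, t) * F (y.1, t) by
      fun_prop).integral_hasStrictDerivAt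
      b y.2).hasDerivAt.const_add
      (1 + ∫ s in a..y.1, A' (s, b) * F (s, b))).congr_of_eventuallyEq ?_
    filter_upwards [(by fun_prop : Continuous fun t : ℝ => |t - b|).continuousAt.eventually_lt
      continuousAt_const hy2] with t ht
    exact hFeq y.1 t hy1.le ht.le

end

theorem fderiv_apply_eq_pu_add_pv {V : Type*} [NormedAddCommGroup V] [NormedSpace ℝ V]
    (f : ℝ × ℝ → V) (q z : ℝ × ℝ) : fderiv ℝ f q z = z.1 • pu f q + z.2 • pv f q := by
  rw [pu, pv, ← map_smul, ← map_smul, ← map_add]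
  simp

theorem eventually_eq_zero_of_norm_partial_le {V : Type*} [NormedAddCommGroup V] [NormedSpace ℝ V]
    {D : ℝ × ℝ → V} {C : ℝ × ℝ → ℝ} {s : Set (ℝ × ℝ)} (hs : IsOpen s) (hC : ContinuousOn C s)
    (hD : ∀ q ∈ s, DifferentiableAt ℝ D q) (hu : ∀ q ∈ s, ‖pu D q‖ ≤ C q * ‖D q‖)
    (hv : ∀ q ∈ s, ‖pv D q‖ ≤ C q * ‖D q‖) {p : ℝ × ℝ} (hp : p ∈ s) (h0 : D p = 0) :
    ∀ᶠ q in 𝓝 p, D q = 0 := by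
  have hev : ∀ᶠ q in 𝓝 p, q ∈ s ∧ C q < C p + 1 :=
    (show ∀ᶠ q in 𝓝 p, q ∈ s from hs.mem_nhds hp).and
      ((hC.continuousAt (hs.mem_nhds hp)).eventually_lt continuousAt_const (by linarith))
  obtain ⟨r, hr, hball⟩ := Metric.eventually_nhds_iff_ball.1 hev
  filter_upwards [Metric.ball_mem_nhds p hr] with x hx
  have hγ : ∀ t ∈ Icc (0 : ℝ) 1, p + t • (x - p) ∈ Metric.ball p r := fun t ht =>
    (convex_ball p r).add_smul_sub_mem (Metric.mem_ball_self hr) hx ht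
  have hd : ∀ t ∈ Icc (0 : ℝ) 1, HasDerivAt (fun t : ℝ => D (p + t • (x - p)))
      (fderiv ℝ D (p + t • (x - p)) (x - p)) t := fun t ht =>
    (hD _ (hball _ (hγ t ht)).1).hasFDerivAt.comp_hasDerivAt t
      (by simpa using ((hasDerivAt_id t).smul_const (x - p)).const_add p)
  have := eq_zero_of_abs_deriv_le_mul_abs_self_of_eq_zero_right
    (f := fun t : ℝ => D (p + t • (x - p))) (K := 2 * ‖x - p‖ * (C p + 1)) (a := 0) (b := 1)
    (fun t ht => (hd t ht).continuousAt.continuousWithinAt)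
    (fun t ht => (hd t (Ico_subset_Icc_self ht)).hasDerivWithinAt) (by simpa using h0)
    (fun t ht => by
      have hb := hball _ (hγ t (Ico_subset_Icc_self ht))
      rw [fderiv_apply_eq_pu_add_pv]
      refine (norm_add_le _ _).trans ?_
      rw [norm_smul, norm_smul]
      have hle : C (p + t • (x - p)) * ‖D (p + t • (x - p))‖
          ≤ (C p + 1) * ‖D (p + t • (x - p))‖ :=
        mul_le_mul_of_nonneg_right hb.2.le (norm_nonneg _)
      have e1 := mul_le_mul (norm_fst_le (x - p)) ((hu _ hb.1).trans hle) (norm_nonneg _)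
        (norm_nonneg _)
      have e2 := mul_le_mul (norm_snd_le (x - p)) ((hv _ hb.1).trans hle) (norm_nonneg _)
        (norm_nonneg _)
      linarith)
    1 (by simp)
  simpa using this

/-- Uniqueness for linear differential inequalities on a connected planar domain. -/
theorem eq_zero_of_norm_partial_le {V : Type*} [NormedAddCommGroup V] [NormedSpace ℝ V]
    {D : ℝ × ℝ → V} {C : ℝ × ℝ → ℝ} {s : Set (ℝ × ℝ)} (hs : IsOpen s) (hc : IsPreconnected s)
    (hC : ContinuousOn C s) (hD : ∀ q ∈ s, DifferentiableAt ℝ D q)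
    (hu : ∀ q ∈ s, ‖pu D q‖ ≤ C q * ‖D q‖) (hv : ∀ q ∈ s, ‖pv D q‖ ≤ C q * ‖D q‖)
    {p : ℝ × ℝ} (hp : p ∈ s) (h0 : D p = 0) {q : ℝ × ℝ} (hq : q ∈ s) : D q = 0 := by
  have hloc := fun {p : ℝ × ℝ} (hp : p ∈ s) (h0 : D p = 0) =>
    eventually_eq_zero_of_norm_partial_le hs hC hD hu hv hp h0
  refine (hc.subset_of_closure_inter_subset (u := {q | ∀ᶠ x in 𝓝 q, D x = 0})
    isOpen_setOfPred_eventually_nhds ⟨p, hp, hloc hp h0⟩ ?_ hq : ∀ᶠ x in 𝓝 q, D x = 0).self_of_nhds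
  rintro x ⟨hx, hxs⟩
  refine hloc hxs ?_
  by_contra hne
  obtain ⟨y, hy, hy'⟩ := (mem_closure_iff_frequently.1 hx).and_eventually
    ((hD x hxs).continuousAt.eventually_ne hne) |>.exists
  exact hy' hy.self_of_nhds

theorem IsParallel.hasFDerivAt_pu_pv {R : Type*} [NormedRing R] [NormedAlgebra ℝ R]
    {A B Φ : ℝ × ℝ → R} {s : Set (ℝ × ℝ)} (h : IsParallel A B s Φ) {q : ℝ × ℝ} (hq : q ∈ s) :
    DifferentiableAt ℝ Φ q ∧ pu Φ q = A q * Φ q ∧ pv Φ q = B q * Φ q := by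
  refine ⟨(h q hq).differentiableAt, ?_, ?_⟩ <;> simp [pu, pv, (h q hq).fderiv]

theorem IsParallel.mono {R : Type*} [NormedRing R] [NormedAlgebra ℝ R]
    {A B Φ : ℝ × ℝ → R} {s t : Set (ℝ × ℝ)} (h : IsParallel A B s Φ) (ht : t ⊆ s) :
    IsParallel A B t Φ := fun q hq => h q (ht hq)

theorem IsParallel.mul_const {R : Type*} [NormedRing R] [NormedAlgebra ℝ R]
    {A B Φ : ℝ × ℝ → R} {s : Set (ℝ × ℝ)} (h : IsParallel A B s Φ) (c : R) :
    IsParallel A B s (fun q => Φ q * c) := fun q hq => by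
  refine ((h q hq).mul_const' c).congr_fderiv ?_
  ext <;> simp [mul_assoc]

theorem IsParallel.eqOn {R : Type*} [NormedRing R] [NormedAlgebra ℝ R]
    {A B Φ Ψ : ℝ × ℝ → R} {s : Set (ℝ × ℝ)} (hs : IsOpen s) (hc : IsPreconnected s)
    (hA : ContinuousOn A s) (hB : ContinuousOn B s) (h : IsParallel A B s Φ)
    (h' : IsParallel A B s Ψ) {p : ℝ × ℝ} (hp : p ∈ s) (h0 : Φ p = Ψ p) : EqOn Φ Ψ s := by
  intro q hq
  have key : ∀ q ∈ s, HasFDerivAt (fun q => Φ q - Ψ q) _ q := fun q hq => (h q hq).sub (h' q hq)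
  refine sub_eq_zero.1 (eq_zero_of_norm_partial_le (D := fun q => Φ q - Ψ q) hs hc
    (C := fun q => ‖A q‖ + ‖B q‖) (hA.norm.add hB.norm) (fun q hq => (key q hq).differentiableAt)
    (fun q hq => ?_) (fun q hq => ?_) hp (by simp [h0]) hq)
  · rw [pu, (key q hq).fderiv]
    have : ‖A q * (Φ q - Ψ q)‖ ≤ _ := norm_mul_le _ _
    have := mul_nonneg (norm_nonneg (B q)) (norm_nonneg (Φ q - Ψ q))
    simp only [mul_sub] at *
    simp
    linarith
  · rw [pv, (key q hq).fderiv]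
    have : ‖B q * (Φ q - Ψ q)‖ ≤ _ := norm_mul_le _ _
    have := mul_nonneg (norm_nonneg (A q)) (norm_nonneg (Φ q - Ψ q))
    simp only [mul_sub] at *
    simp
    linarith

/-- A locally constant cocycle on a simply connected space admits a global section. -/
theorem exists_section_of_locallyConstant_cocycle {X F ι : Type*} [TopologicalSpace X]
    [SimplyConnectedSpace X] [LocallyPathConnectedSpace X] (b : ι → Set X) (hb : ∀ i, IsOpen (b i))
    (idx : X → ι) (hidx : ∀ x, x ∈ b (idx x)) (g : ι → ι → X → F → F)
    (g_self : ∀ i, ∀ x ∈ b i, ∀ v, g i i x v = v)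
    (g_comp : ∀ i j k, ∀ x ∈ b i ∩ b j ∩ b k, ∀ v, g j k x (g i j x v) = g i k x v)
    (g_const : ∀ i j, ∀ x ∈ b i ∩ b j, ∀ v, ∀ᶠ y in 𝓝 x, g i j y v = g i j x v)
    (x₀ : X) (v₀ : F) :
    ∃ c : ι → X → F, c (idx x₀) x₀ = v₀ ∧ (∀ i, ∀ x ∈ b i, ∀ᶠ y in 𝓝 x, c i y = c i x) ∧
      ∀ i j, ∀ x ∈ b i ∩ b j, c j x = g i j x (c i x) := by
  let _ : TopologicalSpace F := ⊥
  have _ : DiscreteTopology F := ⟨rfl⟩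
  let Z : FiberBundleCore ι X F :=
    { baseSet := b
      isOpen_baseSet := hb
      indexAt := idx
      mem_baseSet_at := hidx
      coordChange := g
      coordChange_self := g_self
      continuousOn_coordChange := fun i j => by
        rintro ⟨x, v⟩ ⟨hx, -⟩
        refine ContinuousAt.continuousWithinAt ?_
        refine (continuousAt_const (y := g i j x v)).congr ?_
        rw [EventuallyEq, nhds_prod_eq, nhds_discrete F, prod_pure, eventually_map]
        filter_upwards [g_const i j x hx v] with y hy using hy.symm
      coordChange_comp := g_comp }
  have cov : IsCoveringMap Z.proj := FiberBundle.isCoveringMap (F := F) (E := Z.Fiber)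
  obtain ⟨s, ⟨hs₀, hs⟩, -⟩ := cov.existsUnique_continuousMap_lifts (ContinuousMap.id X) x₀
    ⟨x₀, v₀⟩ rfl
  have hproj : ∀ x, (s x).1 = x := fun x => congrFun hs x
  refine ⟨fun i x => (Z.localTriv i (s x)).2, ?_, fun i x hx => ?_, fun i j x hx => ?_⟩
  · simp only [hs₀, FiberBundleCore.localTriv_apply]
    exact g_self _ _ (hidx x₀) v₀
  · have hsrc : s x ∈ (Z.localTriv i).source := by
      rw [FiberBundleCore.mem_localTriv_source, ← FiberBundleCore.baseSet_at, hproj]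
      exact hx
    have hcont : ContinuousAt (fun y => (Z.localTriv i (s y)).2) x :=
      continuous_snd.continuousAt.comp
        (((Z.localTriv i).continuousAt hsrc).comp s.continuous.continuousAt)
    have := hcont.eventually (p := fun w => w = (Z.localTriv i (s x)).2) (by
      rw [nhds_discrete]; exact eventually_pure.2 rfl)
    exact this
  · simp only [FiberBundleCore.localTriv_apply, hproj]
    exact (g_comp _ i j x ⟨⟨hidx x, hx.1⟩, hx.2⟩ _).symm

section
variable {R : Type*} [NormedRing R] [NormedAlgebra ℝ R] [CompleteSpace R]

theorem exists_isParallel_isUnit_ball {A B : ℝ × ℝ → R} {U : Set (ℝ × ℝ)}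
    (hU : IsOpen U) (hA : ContDiffOn ℝ 1 A U) (hB : ContDiffOn ℝ 1 B U)
    (compat : ∀ q ∈ U, pv A q + A q * B q = pu B q + B q * A q) {x : ℝ × ℝ} (hx : x ∈ U) :
    ∃ r > 0, Metric.ball x r ⊆ U ∧ ∃ Φ : ℝ × ℝ → R, Φ x = 1 ∧
      (∀ y ∈ Metric.ball x r, IsUnit (Φ y)) ∧ IsParallel A B (Metric.ball x r) Φ := by
  obtain ⟨r, hr, hsub, Φ, h1, hΦ⟩ := exists_isParallel_ball hU hA hB compat hx
  have hev : ∀ᶠ y in 𝓝 x, IsUnit (Φ y) :=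
    (hΦ x (Metric.mem_ball_self hr)).continuousAt.eventually
      (Units.isOpen.mem_nhds (by rw [h1]; exact isUnit_one))
  obtain ⟨δ, hδ, hball⟩ := Metric.eventually_nhds_iff_ball.1 hev
  have hle : Metric.ball x (min r δ) ⊆ Metric.ball x r := Metric.ball_subset_ball (min_le_left _ _)
  exact ⟨min r δ, lt_min hr hδ, hle.trans hsub, Φ, h1,
    fun y hy => hball y (Metric.ball_subset_ball (min_le_right _ _) hy), hΦ.mono hle⟩

/-- Frobenius theorem for linear systems on a simply connected planar domain. -/
theorem exists_isParallel {A B : ℝ × ℝ → R} {U : Set (ℝ × ℝ)} (hU : IsOpen U)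
    [SimplyConnectedSpace U] (hA : ContDiffOn ℝ 1 A U) (hB : ContDiffOn ℝ 1 B U)
    (compat : ∀ q ∈ U, pv A q + A q * B q = pu B q + B q * A q) {p : ℝ × ℝ} (hp : p ∈ U) :
    ∃ Φ : ℝ × ℝ → R, Φ p = 1 ∧ IsParallel A B U Φ := by
  have : LocallyPathConnectedSpace U := hU.locallyPathConnectedSpace
  choose r hr hsub Φ hΦ1 hunit hΦ using
    fun x : U => exists_isParallel_isUnit_ball hU hA hB compat x.2
  obtain ⟨c, hc0, hc1, hc2⟩ := exists_section_of_locallyConstant_cocycle (X := U) (F := R) (ι := U)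
    (fun x => (↑) ⁻¹' Metric.ball (x : ℝ × ℝ) (r x))
    (fun x => Metric.isOpen_ball.preimage continuous_subtype_val) id
    (fun x => Metric.mem_ball_self (hr x))
    (fun i j y v => Ring.inverse (Φ j y) * Φ i y * v)
    (fun i x hx v => by rw [Ring.inverse_mul_cancel _ (hunit i x hx), one_mul])
    (fun i j k x hx v => by
      rw [← mul_assoc, ← mul_assoc, mul_assoc _ (Φ j x),
        Ring.mul_inverse_cancel _ (hunit j x hx.1.2),
        mul_one])
    (fun i j x hx v => by
      have hopen := (Metric.isOpen_ball (x := (i : ℝ × ℝ)) (ε := r i)).inter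
        (Metric.isOpen_ball (x := (j : ℝ × ℝ)) (ε := r j))
      have hs := (inter_subset_left (s := Metric.ball (i : ℝ × ℝ) (r i))
        (t := Metric.ball (j : ℝ × ℝ) (r j))).trans (hsub i)
      have heq := IsParallel.eqOn hopen
        ((convex_ball (i : ℝ × ℝ) (r i)).inter (convex_ball (j : ℝ × ℝ) (r j))).isPreconnected
        (hA.continuousOn.mono hs) (hB.continuousOn.mono hs)
        ((hΦ i).mono inter_subset_left)
        (((hΦ j).mono inter_subset_right).mul_const (Ring.inverse (Φ j x) * Φ i x)) hx
        (by simp only [← mul_assoc]; rw [Ring.mul_inverse_cancel _ (hunit j x hx.2), one_mul])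
      filter_upwards [(hopen.preimage continuous_subtype_val).mem_nhds hx] with y hy
      simp only [heq hy]
      rw [← mul_assoc (Ring.inverse (Φ j y)), Ring.inverse_mul_cancel _ (hunit j y hy.2), one_mul])
    ⟨p, hp⟩ 1
  classical
  refine ⟨fun q => if h : q ∈ U then c ⟨q, h⟩ ⟨q, h⟩ else 0, by simpa [hp] using hc0,
    fun q hq => ?_⟩
  have hev : (fun q => if h : q ∈ U then c ⟨q, h⟩ ⟨q, h⟩ else 0)
      =ᶠ[𝓝 q] fun y => Φ ⟨q, hq⟩ y * c ⟨q, hq⟩ ⟨q, hq⟩ := by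
    have h1 := hc1 ⟨q, hq⟩ ⟨q, hq⟩ (Metric.mem_ball_self (hr _))
    have h2 : ∀ᶠ y : U in 𝓝 ⟨q, hq⟩, (y : ℝ × ℝ) ∈ Metric.ball q (r ⟨q, hq⟩) :=
      (Metric.isOpen_ball.preimage continuous_subtype_val).mem_nhds (Metric.mem_ball_self (hr _))
    rw [EventuallyEq, ← hU.isOpenEmbedding_subtypeVal.map_nhds_eq ⟨q, hq⟩, eventually_map]
    filter_upwards [h1, h2] with y hy1 hy2
    rw [dif_pos y.2, hc2 ⟨q, hq⟩ y y ⟨hy2, Metric.mem_ball_self (hr y)⟩, hΦ1, Ring.inverse_one,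
      one_mul, hy1]
  have hd := ((hΦ ⟨q, hq⟩).mul_const (c ⟨q, hq⟩ ⟨q, hq⟩) q (Metric.mem_ball_self (hr _)))
  refine (hd.congr_of_eventuallyEq hev).congr_fderiv ?_
  rw [hev.self_of_nhds]

end

theorem IsParallel.contDiffOn {R : Type*} [NormedRing R] [NormedAlgebra ℝ R]
    {A B Φ : ℝ × ℝ → R} {U : Set (ℝ × ℝ)} (hU : IsOpen U)
    (hA : ContDiffOn ℝ (⊤ : ℕ∞) A U) (hB : ContDiffOn ℝ (⊤ : ℕ∞) B U) (h : IsParallel A B U Φ) :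
    ContDiffOn ℝ (⊤ : ℕ∞) Φ U := by
  rw [contDiffOn_infty]
  intro n
  induction n with
  | zero => exact contDiffOn_zero.2 fun q hq => (h q hq).continuousAt.continuousWithinAt
  | succ n ih =>
    refine (contDiffOn_succ_iff_fderiv_of_isOpen (n := n) hU).2
      ⟨fun q hq => (h q hq).differentiableAt.differentiableWithinAt, by simp, ?_⟩
    refine ContDiffOn.congr (f := fun q =>
      (ContinuousLinearMap.fst ℝ ℝ ℝ).smulRight (A q * Φ q)
        + (ContinuousLinearMap.snd ℝ ℝ ℝ).smulRight (B q * Φ q)) ?_ fun q hq => (h q hq).fderiv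
    have hle : (n : WithTop ℕ∞) ≤ ((⊤ : ℕ∞) : WithTop ℕ∞) := by exact_mod_cast le_top
    exact (contDiffOn_const.smulRight ((hA.of_le hle).mul ih)).add
      (contDiffOn_const.smulRight ((hB.of_le hle).mul ih))

theorem pu_mul {R : Type*} [NormedRing R] [NormedAlgebra ℝ R] {a b : ℝ × ℝ → R} {q : ℝ × ℝ}
    (ha : DifferentiableAt ℝ a q) (hb : DifferentiableAt ℝ b q) :
    pu (fun x => a x * b x) q = a q * pu b q + pu a q * b q := by
  simp [pu, fderiv_fun_mul' ha hb]

theorem pv_mul {R : Type*} [NormedRing R] [NormedAlgebra ℝ R] {a b : ℝ × ℝ → R} {q : ℝ × ℝ}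
    (ha : DifferentiableAt ℝ a q) (hb : DifferentiableAt ℝ b q) :
    pv (fun x => a x * b x) q = a q * pv b q + pv a q * b q := by
  simp [pv, fderiv_fun_mul' ha hb]

theorem ContinuousLinearMap.pu_comp {V W : Type*} [NormedAddCommGroup V] [NormedSpace ℝ V]
    [NormedAddCommGroup W] [NormedSpace ℝ W] (L : V →L[ℝ] W) {f : ℝ × ℝ → V} {q : ℝ × ℝ}
    (hf : DifferentiableAt ℝ f q) : pu (fun x => L (f x)) q = L (pu f q) := by
  exact congrArg (fun T => T (1, 0)) (L.hasFDerivAt.comp q hf.hasFDerivAt).fderiv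

theorem ContinuousLinearMap.pv_comp {V W : Type*} [NormedAddCommGroup V] [NormedSpace ℝ V]
    [NormedAddCommGroup W] [NormedSpace ℝ W] (L : V →L[ℝ] W) {f : ℝ × ℝ → V} {q : ℝ × ℝ}
    (hf : DifferentiableAt ℝ f q) : pv (fun x => L (f x)) q = L (pv f q) := by
  exact congrArg (fun T => T (0, 1)) (L.hasFDerivAt.comp q hf.hasFDerivAt).fderiv

theorem pu_pv_comm {V : Type*} [NormedAddCommGroup V] [NormedSpace ℝ V] {U : Set (ℝ × ℝ)}
    (hU : IsOpen U) {f : ℝ × ℝ → V} (hf : ContDiffOn ℝ (⊤ : ℕ∞) f U) {q : ℝ × ℝ} (hq : q ∈ U) :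
    pu (pv f) q = pv (pu f) q := by
  have hfq := hf.contDiffAt (hU.mem_nhds hq)
  have hsymm : IsSymmSndFDerivAt ℝ f q :=
    hfq.isSymmSndFDerivAt (by simpa using WithTop.coe_le_coe.2 (le_top : (2 : ℕ∞) ≤ ⊤))
  have hd : DifferentiableAt ℝ (fderiv ℝ f) q :=
    (hfq.fderiv_right (m := (⊤ : ℕ∞)) (by simp)).differentiableAt (by simp)
  have h1 := (ContinuousLinearMap.apply ℝ V ((0 : ℝ), (1 : ℝ))).pu_comp hd
  have h2 := (ContinuousLinearMap.apply ℝ V ((1 : ℝ), (0 : ℝ))).pv_comp hd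
  exact h1.trans ((hsymm _ _).trans h2.symm)

theorem ContDiffOn.pu {V : Type*} [NormedAddCommGroup V] [NormedSpace ℝ V] {U : Set (ℝ × ℝ)}
    (hU : IsOpen U) {f : ℝ × ℝ → V} (hf : ContDiffOn ℝ (⊤ : ℕ∞) f U) :
    ContDiffOn ℝ (⊤ : ℕ∞) (pu f) U :=
  (hf.fderiv_of_isOpen hU (by simp)).clm_apply contDiffOn_const

theorem ContDiffOn.pv {V : Type*} [NormedAddCommGroup V] [NormedSpace ℝ V] {U : Set (ℝ × ℝ)}
    (hU : IsOpen U) {f : ℝ × ℝ → V} (hf : ContDiffOn ℝ (⊤ : ℕ∞) f U) :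
    ContDiffOn ℝ (⊤ : ℕ∞) (pv f) U :=
  (hf.fderiv_of_isOpen hU (by simp)).clm_apply contDiffOn_const

theorem ContDiffOn.differentiableAt_of_isOpen {V : Type*} [NormedAddCommGroup V] [NormedSpace ℝ V]
    {U : Set (ℝ × ℝ)} (hU : IsOpen U) {f : ℝ × ℝ → V} (hf : ContDiffOn ℝ (⊤ : ℕ∞) f U)
    {q : ℝ × ℝ} (hq : q ∈ U) : DifferentiableAt ℝ f q :=
  (hf.contDiffAt (hU.mem_nhds hq)).differentiableAt (by simp)

theorem Set.EqOn.pu_eq {V : Type*} [NormedAddCommGroup V] [NormedSpace ℝ V] {U : Set (ℝ × ℝ)}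
    (hU : IsOpen U) {f g : ℝ × ℝ → V} (h : EqOn f g U) {q : ℝ × ℝ} (hq : q ∈ U) :
    pu f q = pu g q := by
  rw [pu, pu, (h.eventuallyEq_of_mem (hU.mem_nhds hq)).fderiv_eq]

theorem Set.EqOn.pv_eq {V : Type*} [NormedAddCommGroup V] [NormedSpace ℝ V] {U : Set (ℝ × ℝ)}
    (hU : IsOpen U) {f g : ℝ × ℝ → V} (h : EqOn f g U) {q : ℝ × ℝ} (hq : q ∈ U) :
    pv f q = pv g q := by
  rw [pv, pv, (h.eventuallyEq_of_mem (hU.mem_nhds hq)).fderiv_eq]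

section
attribute [local instance] Matrix.linftyOpNormedRing Matrix.linftyOpNormedAlgebra

theorem Matrix.contDiffOn_of_entry {U : Set (ℝ × ℝ)} {n : WithTop ℕ∞}
    {A : ℝ × ℝ → Matrix (Fin 3) (Fin 3) ℝ} (h : ∀ i j, ContDiffOn ℝ n (fun q => A q i j) U) :
    ContDiffOn ℝ n A U := by
  let L := (Matrix.ofLinearEquiv (m := Fin 3) (n := Fin 3) (α := ℝ) ℝ).toContinuousLinearEquiv
  have h' : ContDiffOn ℝ n (fun q i j => A q i j) U :=
    contDiffOn_pi.2 fun i => contDiffOn_pi.2 fun j => h i j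
  exact L.contDiff.comp_contDiffOn h'

theorem Matrix.differentiableAt_of_entry {q : ℝ × ℝ}
    {A : ℝ × ℝ → Matrix (Fin 3) (Fin 3) ℝ} (h : ∀ i j, DifferentiableAt ℝ (fun q => A q i j) q) :
    DifferentiableAt ℝ A q := by
  let L := (Matrix.ofLinearEquiv (m := Fin 3) (n := Fin 3) (α := ℝ) ℝ).toContinuousLinearEquiv
  have h' : DifferentiableAt ℝ (fun q i j => A q i j) q :=
    differentiableAt_pi.2 fun i => differentiableAt_pi.2 fun j => h i j
  exact L.differentiableAt.comp q h'

/-- The `i`-th row of a matrix as a continuous linear map. -/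
def rowCLM (i : Fin 3) : Matrix (Fin 3) (Fin 3) ℝ →L[ℝ] (Fin 3 → ℝ) :=
  LinearMap.toContinuousLinearMap
    { toFun := fun M => M i, map_add' := fun _ _ => rfl, map_smul' := fun _ _ => rfl }

/-- Transposition as a continuous linear map. -/
def transposeCLM : Matrix (Fin 3) (Fin 3) ℝ →L[ℝ] Matrix (Fin 3) (Fin 3) ℝ :=
  LinearMap.toContinuousLinearMap (Matrix.transposeLinearEquiv (Fin 3) (Fin 3) ℝ ℝ).toLinearMap

theorem pu_transpose {N : ℝ × ℝ → Matrix (Fin 3) (Fin 3) ℝ} {q : ℝ × ℝ}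
    (hN : DifferentiableAt ℝ N q) : pu (fun x => (N x).transpose) q = (pu N q).transpose :=
  transposeCLM.pu_comp hN

theorem pv_transpose {N : ℝ × ℝ → Matrix (Fin 3) (Fin 3) ℝ} {q : ℝ × ℝ}
    (hN : DifferentiableAt ℝ N q) : pv (fun x => (N x).transpose) q = (pv N q).transpose :=
  transposeCLM.pv_comp hN

theorem pu_row {N : ℝ × ℝ → Matrix (Fin 3) (Fin 3) ℝ} {q : ℝ × ℝ} (hN : DifferentiableAt ℝ N q)
    (i : Fin 3) : pu (fun x => N x i) q = pu N q i := (rowCLM i).pu_comp hN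

theorem pv_row {N : ℝ × ℝ → Matrix (Fin 3) (Fin 3) ℝ} {q : ℝ × ℝ} (hN : DifferentiableAt ℝ N q)
    (i : Fin 3) : pv (fun x => N x i) q = pv N q i := (rowCLM i).pv_comp hN

theorem pu_entry {N : ℝ × ℝ → Matrix (Fin 3) (Fin 3) ℝ} {q : ℝ × ℝ} (hN : DifferentiableAt ℝ N q)
    (i j : Fin 3) : pu (fun x => N x i j) q = pu N q i j :=
  ((ContinuousLinearMap.proj (R := ℝ) (φ := fun _ : Fin 3 => ℝ) j).comp (rowCLM i)).pu_comp hN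

theorem pv_entry {N : ℝ × ℝ → Matrix (Fin 3) (Fin 3) ℝ} {q : ℝ × ℝ} (hN : DifferentiableAt ℝ N q)
    (i j : Fin 3) : pv (fun x => N x i j) q = pv N q i j :=
  ((ContinuousLinearMap.proj (R := ℝ) (φ := fun _ : Fin 3 => ℝ) j).comp (rowCLM i)).pv_comp hN

theorem ContDiffOn.row {U : Set (ℝ × ℝ)} {n : WithTop ℕ∞}
    {N : ℝ × ℝ → Matrix (Fin 3) (Fin 3) ℝ} (hN : ContDiffOn ℝ n N U) (i : Fin 3) :
    ContDiffOn ℝ n (fun q => N q i) U := (rowCLM i).contDiff.comp_contDiffOn hN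

theorem IsParallel.of_pu_pv {R : Type*} [NormedRing R] [NormedAlgebra ℝ R]
    {A B Φ : ℝ × ℝ → R} {s : Set (ℝ × ℝ)}
    (h : ∀ q ∈ s, DifferentiableAt ℝ Φ q ∧ pu Φ q = A q * Φ q ∧ pv Φ q = B q * Φ q) :
    IsParallel A B s Φ := fun q hq => by
  obtain ⟨hd, hu, hv⟩ := h q hq
  refine hd.hasFDerivAt.congr_fderiv (ContinuousLinearMap.ext fun z => ?_)
  simp [fderiv_apply_eq_pu_add_pv, hu, hv]

end

/-- Poincaré lemma on a simply connected planar domain. -/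
theorem exists_pu_eq_pv_eq {U : Set (ℝ × ℝ)} (hU : IsOpen U) (hc : IsPreconnected U)
    [SimplyConnectedSpace U] {a b : ℝ × ℝ → Fin 3 → ℝ} (ha : ContDiffOn ℝ (⊤ : ℕ∞) a U)
    (hb : ContDiffOn ℝ (⊤ : ℕ∞) b U) (hab : ∀ q ∈ U, pv a q = pu b q) :
    ∃ f : ℝ × ℝ → Fin 3 → ℝ, ContDiffOn ℝ (⊤ : ℕ∞) f U ∧ ∀ q ∈ U, pu f q = a q ∧ pv f q = b q := by
  obtain ⟨p, hp⟩ : U.Nonempty := nonempty_coe_sort.1 inferInstance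
  let ι := TrivSqZeroExt.inrCLM ℝ (Fin 3 → ℝ)
  have hA : ContDiffOn ℝ (⊤ : ℕ∞) (fun q => ι (a q)) U := ι.contDiff.comp_contDiffOn ha
  have hB : ContDiffOn ℝ (⊤ : ℕ∞) (fun q => ι (b q)) U := ι.contDiff.comp_contDiffOn hb
  obtain ⟨Φ, hΦp, hΦ⟩ := exists_isParallel hU (hA.of_le (by exact_mod_cast le_top))
    (hB.of_le (by exact_mod_cast le_top))
    (fun q hq => by
      rw [ι.pv_comp (ha.differentiableAt_of_isOpen hU hq),
        ι.pu_comp (hb.differentiableAt_of_isOpen hU hq), hab q hq]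
      simp [ι, TrivSqZeroExt.inr_mul_inr]) hp
  have hfst : ∀ q ∈ U, TrivSqZeroExt.fst (Φ q) = 1 := by
    intro q hq
    have hd : ∀ x ∈ U, HasFDerivAt (fun x => TrivSqZeroExt.fst (Φ x) - 1) 0 x := fun x hx => by
      refine (((TrivSqZeroExt.fstCLM ℝ (Fin 3 → ℝ)).hasFDerivAt.comp x (hΦ x hx)).sub_const
        1).congr_fderiv ?_
      ext <;> simp [ι]
    refine sub_eq_zero.1 (eq_zero_of_norm_partial_le hU hc (C := fun _ => 0) continuousOn_const
      (fun x hx => (hd x hx).differentiableAt) (fun x hx => ?_) (fun x hx => ?_) hp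
      (by simp [hΦp]) hq)
    · simp [pu, (hd x hx).fderiv]
    · simp [pv, (hd x hx).fderiv]
  let σ := TrivSqZeroExt.sndCLM ℝ (Fin 3 → ℝ)
  refine ⟨fun q => σ (Φ q), σ.contDiff.comp_contDiffOn (hΦ.contDiffOn hU hA hB), fun q hq => ?_⟩
  obtain ⟨hd, hu, hv⟩ := hΦ.hasFDerivAt_pu_pv hq
  rw [σ.pu_comp hd, σ.pv_comp hd, hu, hv]
  simp [σ, ι, hfst q hq]

section
attribute [local instance] Matrix.linftyOpNormedRing Matrix.linftyOpNormedAlgebra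

/-- The matrix of the Minkowski inner product. -/
def lorentz : Matrix (Fin 3) (Fin 3) ℝ := !![1, 0, 0; 0, 1, 0; 0, 0, -1]

/-- The Gram matrix of the frame `(f_u, f_v, ψ)`. -/
def gram (E G : ℝ) : Matrix (Fin 3) (Fin 3) ℝ := !![E, 0, 0; 0, G, 1; 0, 1, 0]

/-- Coefficients of `(f_uu, f_uv, ψ_u)` in the frame `(f_u, f_v, ψ)`. -/
def connU (E Eu Ev G Gu X Y : ℝ) : Matrix (Fin 3) (Fin 3) ℝ :=
  !![Eu / (2 * E), X, -(Ev / 2) - X * G; Ev / (2 * E), Y, Gu / 2 - Y * G; -(X / E), 0, -Y]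

/-- Coefficients of `(f_uv, f_vv, ψ_v)` in the frame `(f_u, f_v, ψ)`. -/
def connV (E Ev G Gu Gv Y Z : ℝ) : Matrix (Fin 3) (Fin 3) ℝ :=
  !![Ev / (2 * E), Y, Gu / 2 - Y * G; -(Gu / (2 * E)), Z, Gv / 2 - Z * G; -(Y / E), 0, -Z]

theorem fderiv_div_apply {a b : ℝ × ℝ → ℝ} {q : ℝ × ℝ} (ha : DifferentiableAt ℝ a q)
    (hb : DifferentiableAt ℝ b q) (h0 : b q ≠ 0) (z : ℝ × ℝ) :
    fderiv ℝ (fun x => a x / b x) q z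
      = (fderiv ℝ a q z * b q - a q * fderiv ℝ b q z) / b q ^ 2 := by
  have hinv : HasFDerivAt (fun x => (b x)⁻¹) _ q :=
    (hasDerivAt_inv h0).comp_hasFDerivAt q hb.hasFDerivAt
  have hdiv := (ha.hasFDerivAt.fun_mul hinv).fderiv
  simp only [div_eq_mul_inv] at hdiv ⊢
  rw [hdiv]
  simp
  field_simp
  ring

theorem fderiv_div_const_apply {a : ℝ × ℝ → ℝ} {q : ℝ × ℝ} (ha : DifferentiableAt ℝ a q) (c : ℝ)
    (z : ℝ × ℝ) : fderiv ℝ (fun x => a x / c) q z = fderiv ℝ a q z / c := by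
  simp only [div_eq_mul_inv, fderiv_mul_const ha]
  simp [mul_comm]

theorem pv_connU_add_mul_eq {E Eu Ev G Gu Gv X Y Z : ℝ × ℝ → ℝ} {q : ℝ × ℝ}
    (hE : DifferentiableAt ℝ E q) (hEu : DifferentiableAt ℝ Eu q) (hEv : DifferentiableAt ℝ Ev q)
    (hG : DifferentiableAt ℝ G q) (hGu : DifferentiableAt ℝ Gu q) (hGv : DifferentiableAt ℝ Gv q)
    (hX : DifferentiableAt ℝ X q) (hY : DifferentiableAt ℝ Y q) (hZ : DifferentiableAt ℝ Z q)
    (h0 : E q ≠ 0) (eEu : pu E q = Eu q) (eEv : pv E q = Ev q) (eGu : pu G q = Gu q)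
    (eGv : pv G q = Gv q) (sE : pv Eu q = pu Ev q) (sG : pv Gu q = pu Gv q)
    (hC1 : pv X q - pu Y q
      = (Ev q * X q - Eu q * Y q) / (2 * E q) + (Y q) ^ 2 - X q * Z q)
    (hC2 : pv Y q - pu Z q = -((Gu q * X q + Ev q * Y q) / (2 * E q)))
    (hGauss : pv Ev q + pu Gu q - (Eu q * Gu q + (Ev q) ^ 2) / (2 * E q)
      = 2 * G q * (X q * Z q - (Y q) ^ 2) - Gv q * X q + 2 * Gu q * Y q + Ev q * Z q) :
    pv (fun x => connU (E x) (Eu x) (Ev x) (G x) (Gu x) (X x) (Y x)) q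
      + connU (E q) (Eu q) (Ev q) (G q) (Gu q) (X q) (Y q)
        * connV (E q) (Ev q) (G q) (Gu q) (Gv q) (Y q) (Z q)
    = pu (fun x => connV (E x) (Ev x) (G x) (Gu x) (Gv x) (Y x) (Z x)) q
      + connV (E q) (Ev q) (G q) (Gu q) (Gv q) (Y q) (Z q)
        * connU (E q) (Eu q) (Ev q) (G q) (Gu q) (X q) (Y q) := by
  have h2 : 2 * E q ≠ 0 := mul_ne_zero two_ne_zero h0
  have hA : DifferentiableAt ℝ
      (fun x => connU (E x) (Eu x) (Ev x) (G x) (Gu x) (X x) (Y x)) q :=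
    Matrix.differentiableAt_of_entry fun i j => by
      fin_cases i <;> fin_cases j <;> simp [connU] <;> fun_prop (disch := assumption)
  have hB : DifferentiableAt ℝ
      (fun x => connV (E x) (Ev x) (G x) (Gu x) (Gv x) (Y x) (Z x)) q :=
    Matrix.differentiableAt_of_entry fun i j => by
      fin_cases i <;> fin_cases j <;> simp [connV] <;> fun_prop (disch := assumption)
  ext i j
  rw [Matrix.add_apply, Matrix.add_apply, ← pv_entry hA, ← pu_entry hB, Matrix.mul_apply,
    Matrix.mul_apply, Fin.sum_univ_three, Fin.sum_univ_three]
  have eX := eq_add_of_sub_eq hC1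
  have eY := eq_add_of_sub_eq hC2
  have eEvv := eq_sub_of_add_eq (eq_add_of_sub_eq hGauss)
  simp only [pu, pv] at *
  fin_cases i <;> fin_cases j <;> simp [connU, connV]
  all_goals
    try simp (disch := first | assumption | fun_prop (disch := assumption))
      [fderiv_div_apply, fderiv_div_const_apply, fderiv_fun_sub, fderiv_fun_mul]
  all_goals
    (try simp only [eEu, eEv, eGu, eGv, sE, sG, eX, eY, eEvv]); field_simp <;> ring

theorem mul_lorentz_mul_transpose_apply (M N : Matrix (Fin 3) (Fin 3) ℝ) (i j : Fin 3) :
    (M * lorentz * N.transpose) i j = mink (M i) (N j) := by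
  simp [Matrix.mul_apply, Fin.sum_univ_three, lorentz, mink]
  ring

theorem gram_transpose (E G : ℝ) : (gram E G).transpose = gram E G := by
  ext i j
  fin_cases i <;> fin_cases j <;> simp [gram]

theorem isUnit_gram {E : ℝ} (hE : E ≠ 0) (G : ℝ) : IsUnit (gram E G) := by
  rw [Matrix.isUnit_iff_isUnit_det]
  simp [gram, Matrix.det_fin_three, hE]

theorem connU_mul_gram {E : ℝ} (hE : E ≠ 0) (Eu Ev G Gu X Y : ℝ) :
    connU E Eu Ev G Gu X Y * gram E G
      = !![Eu / 2, -(Ev / 2), X; Ev / 2, Gu / 2, Y; -X, -Y, 0] := by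
  ext i j
  fin_cases i <;> fin_cases j <;>
    simp [connU, gram, Matrix.mul_apply, Fin.sum_univ_three] <;> field_simp

theorem connV_mul_gram {E : ℝ} (hE : E ≠ 0) (Ev G Gu Gv Y Z : ℝ) :
    connV E Ev G Gu Gv Y Z * gram E G
      = !![Ev / 2, Gu / 2, Y; -(Gu / 2), Gv / 2, Z; -Y, -Z, 0] := by
  ext i j
  fin_cases i <;> fin_cases j <;>
    simp [connV, gram, Matrix.mul_apply, Fin.sum_univ_three] <;> field_simp

theorem differentiableAt_gram {E G : ℝ × ℝ → ℝ} {q : ℝ × ℝ} (hE : DifferentiableAt ℝ E q)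
    (hG : DifferentiableAt ℝ G q) : DifferentiableAt ℝ (fun x => gram (E x) (G x)) q :=
  Matrix.differentiableAt_of_entry fun i j => by
    fin_cases i <;> fin_cases j <;> simp [gram, hE, hG]

theorem pu_gram {E G : ℝ × ℝ → ℝ} {q : ℝ × ℝ} (hE : DifferentiableAt ℝ E q)
    (hG : DifferentiableAt ℝ G q) (h0 : E q ≠ 0) (Ev X Y : ℝ) :
    pu (fun x => gram (E x) (G x)) q
      = connU (E q) (pu E q) Ev (G q) (pu G q) X Y * gram (E q) (G q)
        + gram (E q) (G q) * (connU (E q) (pu E q) Ev (G q) (pu G q) X Y).transpose := by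
  rw [← gram_transpose (E q) (G q), ← Matrix.transpose_mul, gram_transpose, connU_mul_gram h0]
  ext i j
  rw [← pu_entry (differentiableAt_gram hE hG)]
  fin_cases i <;> fin_cases j <;> simp [gram] <;> simp [pu]

theorem pv_gram {E G : ℝ × ℝ → ℝ} {q : ℝ × ℝ} (hE : DifferentiableAt ℝ E q)
    (hG : DifferentiableAt ℝ G q) (h0 : E q ≠ 0) (Gu Y Z : ℝ) :
    pv (fun x => gram (E x) (G x)) q
      = connV (E q) (pv E q) (G q) Gu (pv G q) Y Z * gram (E q) (G q)
        + gram (E q) (G q) * (connV (E q) (pv E q) (G q) Gu (pv G q) Y Z).transpose := by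
  rw [← gram_transpose (E q) (G q), ← Matrix.transpose_mul, gram_transpose, connV_mul_gram h0]
  ext i j
  rw [← pv_entry (differentiableAt_gram hE hG)]
  fin_cases i <;> fin_cases j <;> simp [gram] <;> simp [pv]

/-- A parallel frame for a metric connection keeps its Gram matrix. -/
theorem IsParallel.mul_lorentz_mul_transpose {A B N g : ℝ × ℝ → Matrix (Fin 3) (Fin 3) ℝ}
    {U : Set (ℝ × ℝ)} (hU : IsOpen U) (hc : IsPreconnected U) (hA : ContinuousOn A U)
    (hB : ContinuousOn B U) (hN : IsParallel A B U N) (hg : ∀ q ∈ U, DifferentiableAt ℝ g q)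
    (hgu : ∀ q ∈ U, pu g q = A q * g q + g q * (A q).transpose)
    (hgv : ∀ q ∈ U, pv g q = B q * g q + g q * (B q).transpose) {p : ℝ × ℝ} (hp : p ∈ U)
    (h0 : N p * lorentz * (N p).transpose = g p) {q : ℝ × ℝ} (hq : q ∈ U) :
    N q * lorentz * (N q).transpose = g q := by
  have hd : ∀ q ∈ U, DifferentiableAt ℝ (fun x => N x * lorentz * (N x).transpose) q :=
    fun q hq => ((hN q hq).differentiableAt.mul_const lorentz).mul
      (transposeCLM.differentiableAt.comp q (hN q hq).differentiableAt)
  have hcA : ContinuousOn (fun q => ‖A q‖ + ‖(A q).transpose‖) U :=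
    hA.norm.add (transposeCLM.continuous.comp_continuousOn hA).norm
  have hcB : ContinuousOn (fun q => ‖B q‖ + ‖(B q).transpose‖) U :=
    hB.norm.add (transposeCLM.continuous.comp_continuousOn hB).norm
  have hle : ∀ M D : Matrix (Fin 3) (Fin 3) ℝ,
      ‖M * D + D * M.transpose‖ ≤ (‖M‖ + ‖M.transpose‖) * ‖D‖ := fun M D =>
    (norm_add_le _ _).trans (by
      have h1 := norm_mul_le M D
      have h2 := norm_mul_le D M.transpose
      linarith)
  refine sub_eq_zero.1 (eq_zero_of_norm_partial_le
    (D := fun x => N x * lorentz * (N x).transpose - g x) hU hc (hcA.add hcB)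
    (fun x hx => (hd x hx).sub (hg x hx)) (fun x hx => ?_) (fun x hx => ?_) hp
    (by simp [h0]) hq)
  · obtain ⟨dN, hu, -⟩ := hN.hasFDerivAt_pu_pv hx
    have dT : DifferentiableAt ℝ (fun y => (N y).transpose) x :=
      transposeCLM.differentiableAt.comp x dN
    have e : pu (fun x => N x * lorentz * (N x).transpose - g x) x
        = A x * (N x * lorentz * (N x).transpose - g x)
          + (N x * lorentz * (N x).transpose - g x) * (A x).transpose := by
      have h1 : pu (fun x => N x * lorentz * (N x).transpose - g x) x
          = pu (fun x => N x * lorentz * (N x).transpose) x - pu g x := by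
        simp [pu, fderiv_fun_sub (hd x hx) (hg x hx)]
      rw [h1, pu_mul (dN.mul_const lorentz) dT,
        pu_mul dN (differentiableAt_const _), pu_transpose dN, hu, hgu x hx]
      simp [pu, Matrix.transpose_mul, mul_assoc, mul_sub, sub_mul]
      abel
    rw [e]
    refine (hle _ _).trans (mul_le_mul_of_nonneg_right ?_ (norm_nonneg _))
    exact le_add_of_nonneg_right (add_nonneg (norm_nonneg _) (norm_nonneg _))
  · obtain ⟨dN, -, hv⟩ := hN.hasFDerivAt_pu_pv hx
    have dT : DifferentiableAt ℝ (fun y => (N y).transpose) x :=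
      transposeCLM.differentiableAt.comp x dN
    have e : pv (fun x => N x * lorentz * (N x).transpose - g x) x
        = B x * (N x * lorentz * (N x).transpose - g x)
          + (N x * lorentz * (N x).transpose - g x) * (B x).transpose := by
      have h1 : pv (fun x => N x * lorentz * (N x).transpose - g x) x
          = pv (fun x => N x * lorentz * (N x).transpose) x - pv g x := by
        simp [pv, fderiv_fun_sub (hd x hx) (hg x hx)]
      rw [h1, pv_mul (dN.mul_const lorentz) dT,
        pv_mul dN (differentiableAt_const _), pv_transpose dN, hv, hgv x hx]
      simp [pv, Matrix.transpose_mul, mul_assoc, mul_sub, sub_mul]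
      abel
    rw [e]
    refine (hle _ _).trans (mul_le_mul_of_nonneg_right ?_ (norm_nonneg _))
    exact le_add_of_nonneg_left (add_nonneg (norm_nonneg _) (norm_nonneg _))

theorem mink_comm (x y : Fin 3 → ℝ) : mink x y = mink y x := by
  simp [mink, mul_comm]

theorem mink_zero_left (x : Fin 3 → ℝ) : mink 0 x = 0 := by
  simp [mink]

theorem mink_add_smul_left (s t : ℝ) (x y z : Fin 3 → ℝ) :
    mink (s • x + t • y) z = s * mink x z + t * mink y z := by
  simp [mink]
  ring

theorem fderiv_mink_apply {a b : ℝ × ℝ → Fin 3 → ℝ} {q : ℝ × ℝ} (ha : DifferentiableAt ℝ a q)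
    (hb : DifferentiableAt ℝ b q) (z : ℝ × ℝ) :
    fderiv ℝ (fun x => mink (a x) (b x)) q z
      = mink (fderiv ℝ a q z) (b q) + mink (a q) (fderiv ℝ b q z) := by
  have ha' := fun i => hasFDerivAt_pi'.1 ha.hasFDerivAt i
  have hb' := fun i => hasFDerivAt_pi'.1 hb.hasFDerivAt i
  have h := ((((ha' 0).fun_mul (hb' 0)).fun_add ((ha' 1).fun_mul (hb' 1))).fun_sub
    ((ha' 2).fun_mul (hb' 2))).fderiv
  simp only [mink]
  rw [h]
  simp
  ring

theorem mink_pu_add_mink_pu {U : Set (ℝ × ℝ)} (hU : IsOpen U) {q : ℝ × ℝ} (hq : q ∈ U)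
    {a b : ℝ × ℝ → Fin 3 → ℝ} {c : ℝ × ℝ → ℝ} (ha : DifferentiableAt ℝ a q)
    (hb : DifferentiableAt ℝ b q) (h : ∀ x ∈ U, mink (a x) (b x) = c x) :
    mink (pu a q) (b q) + mink (a q) (pu b q) = pu c q := by
  rw [← EqOn.pu_eq hU h hq]
  exact (fderiv_mink_apply ha hb _).symm

theorem mink_pv_add_mink_pv {U : Set (ℝ × ℝ)} (hU : IsOpen U) {q : ℝ × ℝ} (hq : q ∈ U)
    {a b : ℝ × ℝ → Fin 3 → ℝ} {c : ℝ × ℝ → ℝ} (ha : DifferentiableAt ℝ a q)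
    (hb : DifferentiableAt ℝ b q) (h : ∀ x ∈ U, mink (a x) (b x) = c x) :
    mink (pv a q) (b q) + mink (a q) (pv b q) = pv c q := by
  rw [← EqOn.pv_eq hU h hq]
  exact (fderiv_mink_apply ha hb _).symm

/-- The pair `(f, ψ)` realizes `E, 0, G` as first and `X, Y, Z` as second fundamental form. -/
def IsRealization (E G X Y Z : ℝ × ℝ → ℝ) (U : Set (ℝ × ℝ)) (f ψ : ℝ × ℝ → Fin 3 → ℝ) : Prop :=
  ∀ q ∈ U,
    mink (pu f q) (pu f q) = E q ∧ mink (pu f q) (pv f q) = 0 ∧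
    mink (pv f q) (pv f q) = G q ∧ mink (ψ q) (ψ q) = 0 ∧
    mink (ψ q) (pu f q) = 0 ∧ mink (ψ q) (pv f q) = 1 ∧
    mink (pu (pu f) q) (ψ q) = X q ∧ mink (pv (pu f) q) (ψ q) = Y q ∧
    mink (pv (pv f) q) (ψ q) = Z q

/-- The matrix with rows `f_u, f_v, ψ`. -/
def frame (f ψ : ℝ × ℝ → Fin 3 → ℝ) (q : ℝ × ℝ) : Matrix (Fin 3) (Fin 3) ℝ :=
  Matrix.of ![pu f q, pv f q, ψ q]

theorem contDiffOn_frame {U : Set (ℝ × ℝ)} (hU : IsOpen U) {f ψ : ℝ × ℝ → Fin 3 → ℝ}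
    (hf : ContDiffOn ℝ (⊤ : ℕ∞) f U) (hψ : ContDiffOn ℝ (⊤ : ℕ∞) ψ U) :
    ContDiffOn ℝ (⊤ : ℕ∞) (frame f ψ) U :=
  Matrix.contDiffOn_of_entry fun i j => by
    fin_cases i
    · exact contDiffOn_pi.1 (hf.pu hU) j
    · exact contDiffOn_pi.1 (hf.pv hU) j
    · exact contDiffOn_pi.1 hψ j

theorem frame_zero (f ψ : ℝ × ℝ → Fin 3 → ℝ) (q : ℝ × ℝ) : frame f ψ q 0 = pu f q := rfl

theorem frame_one (f ψ : ℝ × ℝ → Fin 3 → ℝ) (q : ℝ × ℝ) : frame f ψ q 1 = pv f q := rfl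

theorem frame_two (f ψ : ℝ × ℝ → Fin 3 → ℝ) (q : ℝ × ℝ) : frame f ψ q 2 = ψ q := rfl

theorem IsRealization.frame_mul {E G X Y Z : ℝ × ℝ → ℝ} {U : Set (ℝ × ℝ)}
    {f ψ : ℝ × ℝ → Fin 3 → ℝ} (h : IsRealization E G X Y Z U f ψ) {q : ℝ × ℝ} (hq : q ∈ U) :
    frame f ψ q * lorentz * (frame f ψ q).transpose = gram (E q) (G q) := by
  obtain ⟨h1, h2, h3, h4, h5, h6, -⟩ := h q hq
  ext i j
  rw [mul_lorentz_mul_transpose_apply]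
  fin_cases i <;> fin_cases j <;>
    simp [frame_zero, frame_one, frame_two, gram, *, mink_comm (pv f q) (pu f q),
      mink_comm _ (ψ q)]

theorem isUnit_and_isUnit_of_isUnit_mul {M N : Matrix (Fin 3) (Fin 3) ℝ} (h : IsUnit (M * N)) :
    IsUnit M ∧ IsUnit N := by
  simp only [Matrix.isUnit_iff_isUnit_det, Matrix.det_mul] at *
  exact IsUnit.mul_iff.1 h

theorem IsRealization.isParallel {E G X Y Z : ℝ × ℝ → ℝ} {U : Set (ℝ × ℝ)} (hU : IsOpen U)
    {f ψ : ℝ × ℝ → Fin 3 → ℝ} (hf : ContDiffOn ℝ (⊤ : ℕ∞) f U)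
    (hψ : ContDiffOn ℝ (⊤ : ℕ∞) ψ U) (h0 : ∀ q ∈ U, E q ≠ 0)
    (h : IsRealization E G X Y Z U f ψ) :
    IsParallel (fun q => connU (E q) (pu E q) (pv E q) (G q) (pu G q) (X q) (Y q))
      (fun q => connV (E q) (pv E q) (G q) (pu G q) (pv G q) (Y q) (Z q)) U (frame f ψ) := by
  refine IsParallel.of_pu_pv fun q hq => ?_
  have hd := (contDiffOn_frame hU hf hψ).differentiableAt_of_isOpen hU hq
  have hgram := h.frame_mul hq
  have hunit : IsUnit (lorentz * (frame f ψ q).transpose) :=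
    (isUnit_and_isUnit_of_isUnit_mul (by
      rw [← mul_assoc, hgram]; exact isUnit_gram (h0 q hq) (G q))).2
  have d1 := (hf.pu hU).differentiableAt_of_isOpen hU hq
  have d2 := (hf.pv hU).differentiableAt_of_isOpen hU hq
  have d3 := hψ.differentiableAt_of_isOpen hU hq
  have hrel := fun {a b : ℝ × ℝ → Fin 3 → ℝ} {c : ℝ × ℝ → ℝ} (ha : DifferentiableAt ℝ a q)
    (hb : DifferentiableAt ℝ b q) (hc : ∀ x ∈ U, mink (a x) (b x) = c x) =>
    And.intro (mink_pu_add_mink_pu hU hq ha hb hc) (mink_pv_add_mink_pv hU hq ha hb hc)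
  obtain ⟨u11, v11⟩ := hrel d1 d1 fun x hx => (h x hx).1
  obtain ⟨u12, v12⟩ := hrel (c := fun _ => 0) d1 d2 fun x hx => (h x hx).2.1
  obtain ⟨u22, v22⟩ := hrel d2 d2 fun x hx => (h x hx).2.2.1
  obtain ⟨u33, v33⟩ := hrel (c := fun _ => 0) d3 d3 fun x hx => (h x hx).2.2.2.1
  obtain ⟨u31, v31⟩ := hrel (c := fun _ => 0) d3 d1 fun x hx => (h x hx).2.2.2.2.1
  obtain ⟨u32, v32⟩ := hrel (c := fun _ => 1) d3 d2 fun x hx => (h x hx).2.2.2.2.2.1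
  obtain ⟨-, -, -, -, -, -, hX, hY, hZ⟩ := h q hq
  rw [pu_pv_comm hU hf hq] at u12 u22 u32
  have pu_const : ∀ c : ℝ, pu (fun _ : ℝ × ℝ => c) q = 0 := fun c => by simp [pu]
  have pv_const : ∀ c : ℝ, pv (fun _ : ℝ × ℝ => c) q = 0 := fun c => by simp [pv]
  rw [pu_const] at u12 u31 u32 u33
  rw [pv_const] at v12 v31 v32 v33
  have c1 := fun x => mink_comm (pu f q) x
  have c2 := fun x => mink_comm (pv f q) x
  have c3 := fun x => mink_comm (ψ q) x
  rw [c1] at u11 u12 v11 v12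
  rw [c2] at u22 v22
  rw [c3] at u31 u32 u33 v31 v32 v33
  have ru0 : pu (frame f ψ) q 0 = pu (pu f) q := (pu_row hd 0).symm
  have ru1 : pu (frame f ψ) q 1 = pv (pu f) q := (pu_row hd 1).symm.trans (pu_pv_comm hU hf hq)
  have ru2 : pu (frame f ψ) q 2 = pu ψ q := (pu_row hd 2).symm
  have rv0 : pv (frame f ψ) q 0 = pv (pu f) q := (pv_row hd 0).symm
  have rv1 : pv (frame f ψ) q 1 = pv (pv f) q := (pv_row hd 1).symm
  have rv2 : pv (frame f ψ) q 2 = pv ψ q := (pv_row hd 2).symm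
  refine ⟨hd, hunit.mul_right_cancel ?_, hunit.mul_right_cancel ?_⟩
  · rw [mul_assoc (connU _ _ _ _ _ _ _), ← mul_assoc (frame f ψ q), hgram, ← mul_assoc,
      connU_mul_gram (h0 q hq)]
    ext i j
    rw [mul_lorentz_mul_transpose_apply]
    fin_cases i <;> fin_cases j <;> simp [frame_zero, frame_one, frame_two, ru0, ru1, ru2] <;>
      linarith
  · rw [mul_assoc (connV _ _ _ _ _ _ _), ← mul_assoc (frame f ψ q), hgram, ← mul_assoc,
      connV_mul_gram (h0 q hq)]
    ext i j
    rw [mul_lorentz_mul_transpose_apply]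
    fin_cases i <;> fin_cases j <;> simp [frame_zero, frame_one, frame_two, rv0, rv1, rv2] <;>
      linarith

theorem contDiffOn_connU {E Eu Ev G Gu X Y : ℝ × ℝ → ℝ} {U : Set (ℝ × ℝ)} {n : WithTop ℕ∞}
    (hE : ContDiffOn ℝ n E U) (hEu : ContDiffOn ℝ n Eu U) (hEv : ContDiffOn ℝ n Ev U)
    (hG : ContDiffOn ℝ n G U) (hGu : ContDiffOn ℝ n Gu U) (hX : ContDiffOn ℝ n X U)
    (hY : ContDiffOn ℝ n Y U) (h0 : ∀ q ∈ U, E q ≠ 0) :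
    ContDiffOn ℝ n (fun q => connU (E q) (Eu q) (Ev q) (G q) (Gu q) (X q) (Y q)) U := by
  have h2 : ∀ q ∈ U, 2 * E q ≠ 0 := fun q hq => mul_ne_zero two_ne_zero (h0 q hq)
  refine Matrix.contDiffOn_of_entry fun i j => ?_
  fin_cases i <;> fin_cases j <;> simp [connU] <;> fun_prop (disch := assumption)

theorem contDiffOn_connV {E Ev G Gu Gv Y Z : ℝ × ℝ → ℝ} {U : Set (ℝ × ℝ)} {n : WithTop ℕ∞}
    (hE : ContDiffOn ℝ n E U) (hEv : ContDiffOn ℝ n Ev U) (hG : ContDiffOn ℝ n G U)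
    (hGu : ContDiffOn ℝ n Gu U) (hGv : ContDiffOn ℝ n Gv U) (hY : ContDiffOn ℝ n Y U)
    (hZ : ContDiffOn ℝ n Z U) (h0 : ∀ q ∈ U, E q ≠ 0) :
    ContDiffOn ℝ n (fun q => connV (E q) (Ev q) (G q) (Gu q) (Gv q) (Y q) (Z q)) U := by
  have h2 : ∀ q ∈ U, 2 * E q ≠ 0 := fun q hq => mul_ne_zero two_ne_zero (h0 q hq)
  refine Matrix.contDiffOn_of_entry fun i j => ?_
  fin_cases i <;> fin_cases j <;> simp [connV] <;> fun_prop (disch := assumption)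

/-- Two realizations of the same data differ by an isometry. -/
theorem IsRealization.exists_isometry {E G X Y Z : ℝ × ℝ → ℝ} {U : Set (ℝ × ℝ)} (hU : IsOpen U)
    (hconn : IsConnected U)
    (hE : ContDiffOn ℝ (⊤ : ℕ∞) E U) (hG : ContDiffOn ℝ (⊤ : ℕ∞) G U)
    (hX : ContDiffOn ℝ (⊤ : ℕ∞) X U) (hY : ContDiffOn ℝ (⊤ : ℕ∞) Y U)
    (hZ : ContDiffOn ℝ (⊤ : ℕ∞) Z U) (h0 : ∀ q ∈ U, E q ≠ 0)
    {f ψ f' ψ' : ℝ × ℝ → Fin 3 → ℝ}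
    (hf : ContDiffOn ℝ (⊤ : ℕ∞) f U) (hψ : ContDiffOn ℝ (⊤ : ℕ∞) ψ U)
    (h : IsRealization E G X Y Z U f ψ)
    (hf' : ContDiffOn ℝ (⊤ : ℕ∞) f' U) (hψ' : ContDiffOn ℝ (⊤ : ℕ∞) ψ' U)
    (h' : IsRealization E G X Y Z U f' ψ') :
    ∃ (A : Matrix (Fin 3) (Fin 3) ℝ) (b : Fin 3 → ℝ), A.transpose * lorentz * A = lorentz ∧
      ∀ q ∈ U, f' q = A.mulVec (f q) + b ∧ ψ' q = A.mulVec (ψ q) := by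
  have hA := contDiffOn_connU hE (hE.pu hU) (hE.pv hU) hG (hG.pu hU) hX hY h0
  have hB := contDiffOn_connV hE (hE.pv hU) hG (hG.pu hU) (hG.pv hU) hY hZ h0
  obtain ⟨p, hp⟩ := hconn.nonempty
  let N := frame f ψ
  let N' := frame f' ψ'
  have hN : N p * lorentz * (N p).transpose = gram (E p) (G p) := h.frame_mul hp
  have hN' : N' p * lorentz * (N' p).transpose = gram (E p) (G p) := h'.frame_mul hp
  have hunit := isUnit_and_isUnit_of_isUnit_mul (M := N p * lorentz) (N := (N p).transpose) (by
    rw [hN]; exact isUnit_gram (h0 p hp) (G p))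
  have hunit1 : IsUnit (N p) := (isUnit_and_isUnit_of_isUnit_mul hunit.1).1
  obtain ⟨Q, hQ⟩ : ∃ Q, N p * Q = N' p := hunit1.exists_right_inv.imp' (· * N' p) fun B hB => by
    rw [← mul_assoc, hB, one_mul]
  have heq : EqOn N' (fun q => N q * Q) U := (h'.isParallel hU hf' hψ' h0).eqOn hU
    hconn.isPreconnected hA.continuousOn hB.continuousOn
    ((h.isParallel hU hf hψ h0).mul_const Q) hp hQ.symm
  have hrow : ∀ q ∈ U, ∀ i, N' q i = Q.transpose.mulVec (N q i) := fun q hq i =>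
    (congrFun (heq hq) i).trans
      ((Matrix.mul_apply_eq_vecMul (N q) Q i).trans (Matrix.mulVec_transpose Q (N q i)).symm)
  let L : (Fin 3 → ℝ) →L[ℝ] (Fin 3 → ℝ) := LinearMap.toContinuousLinearMap Q.transpose.mulVecLin
  refine ⟨Q.transpose, f' p - Q.transpose.mulVec (f p), ?_, fun q hq => ⟨?_, hrow q hq 2⟩⟩
  · rw [Matrix.transpose_transpose]
    refine hunit1.mul_left_cancel (hunit.2.mul_right_cancel ?_)
    rw [hN, ← hN', ← hQ, Matrix.transpose_mul]
    simp only [mul_assoc]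
  · have hd : ∀ x ∈ U, DifferentiableAt ℝ f' x ∧ DifferentiableAt ℝ f x := fun x hx =>
      ⟨hf'.differentiableAt_of_isOpen hU hx, hf.differentiableAt_of_isOpen hU hx⟩
    have hder : ∀ x ∈ U, HasFDerivAt (fun x => f' x - L (f x) - (f' p - L (f p)))
        (fderiv ℝ f' x - L.comp (fderiv ℝ f x)) x := fun x hx =>
      ((hd x hx).1.hasFDerivAt.sub (L.hasFDerivAt.comp x (hd x hx).2.hasFDerivAt)).sub_const _
    have := eq_zero_of_norm_partial_le hU hconn.isPreconnected (C := fun _ => 0) continuousOn_const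
      (fun x hx => (hder x hx).differentiableAt)
      (fun x hx => by
        rw [pu, (hder x hx).fderiv]
        have : fderiv ℝ f' x (1, 0) = L (fderiv ℝ f x (1, 0)) := hrow x hx 0
        simp [this])
      (fun x hx => by
        rw [pv, (hder x hx).fderiv]
        have : fderiv ℝ f' x (0, 1) = L (fderiv ℝ f x (0, 1)) := hrow x hx 1
        simp [this]) hp (by simp) hq
    rw [← sub_eq_zero, ← this]
    simp only [L, LinearMap.coe_toContinuousLinearMap', Matrix.mulVecLin_apply]
    abel

theorem exists_mul_lorentz_mul_transpose_eq_gram {E : ℝ} (hE : 0 < E) (G : ℝ) :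
    ∃ C : Matrix (Fin 3) (Fin 3) ℝ, C * lorentz * C.transpose = gram E G := by
  refine ⟨!![√E, 0, 0; 0, (G + 1) / 2, (G - 1) / 2; 0, 1, 1], ?_⟩
  ext i j
  rw [mul_lorentz_mul_transpose_apply]
  fin_cases i <;> fin_cases j <;> simp [mink, gram, Real.mul_self_sqrt hE.le] <;> ring

theorem connV_zero_eq_connU_one (E Eu Ev G Gu Gv X Y Z : ℝ) :
    connV E Ev G Gu Gv Y Z 0 = connU E Eu Ev G Gu X Y 1 := rfl

theorem IsRealization.linearIndependent {E G X Y Z : ℝ × ℝ → ℝ} {U : Set (ℝ × ℝ)}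
    {f ψ : ℝ × ℝ → Fin 3 → ℝ} (h : IsRealization E G X Y Z U f ψ) {q : ℝ × ℝ} (hq : q ∈ U)
    (h0 : E q ≠ 0) : LinearIndependent ℝ ![pu f q, pv f q] := by
  obtain ⟨h1, h2, -, -, h5, h6, -⟩ := h q hq
  refine LinearIndependent.pair_iff.2 fun s t hst => ?_
  have e1 := mink_add_smul_left s t (pu f q) (pv f q) (ψ q)
  have e2 := mink_add_smul_left s t (pu f q) (pv f q) (pu f q)
  rw [hst, mink_zero_left, mink_comm _ (ψ q), mink_comm _ (ψ q), h5, h6] at e1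
  rw [hst, mink_zero_left, mink_comm (pv f q), h1, h2] at e2
  have ht : t = 0 := by linarith
  have hs : s * E q = 0 := by linarith
  exact ⟨(mul_eq_zero.1 hs).resolve_right h0, ht⟩

/-- A parallel frame with the prescribed Gram matrix integrates to a realization. -/
theorem IsParallel.exists_isRealization {E G X Y Z : ℝ × ℝ → ℝ} {U : Set (ℝ × ℝ)} (hU : IsOpen U)
    (hc : IsPreconnected U) [SimplyConnectedSpace U] (h0 : ∀ q ∈ U, E q ≠ 0)
    {N : ℝ × ℝ → Matrix (Fin 3) (Fin 3) ℝ} (hs : ContDiffOn ℝ (⊤ : ℕ∞) N U)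
    (hN : IsParallel (fun q => connU (E q) (pu E q) (pv E q) (G q) (pu G q) (X q) (Y q))
      (fun q => connV (E q) (pv E q) (G q) (pu G q) (pv G q) (Y q) (Z q)) U N)
    (hgram : ∀ q ∈ U, N q * lorentz * (N q).transpose = gram (E q) (G q)) :
    ∃ f ψ : ℝ × ℝ → Fin 3 → ℝ, ContDiffOn ℝ (⊤ : ℕ∞) f U ∧ ContDiffOn ℝ (⊤ : ℕ∞) ψ U ∧
      IsRealization E G X Y Z U f ψ := by
  have hrow : ∀ q ∈ U, ∀ i,
      pu (fun x => N x i) q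
        = (connU (E q) (pu E q) (pv E q) (G q) (pu G q) (X q) (Y q) * N q) i ∧
      pv (fun x => N x i) q
        = (connV (E q) (pv E q) (G q) (pu G q) (pv G q) (Y q) (Z q) * N q) i := fun q hq i => by
    obtain ⟨hd, hu, hv⟩ := hN.hasFDerivAt_pu_pv hq
    rw [pu_row hd, pv_row hd, hu, hv]
    exact ⟨rfl, rfl⟩
  obtain ⟨f, hf, hfN⟩ := exists_pu_eq_pv_eq hU hc (hs.row 0) (hs.row 1) fun q hq => by
    rw [(hrow q hq 0).2, (hrow q hq 1).1, Matrix.mul_apply_eq_vecMul, Matrix.mul_apply_eq_vecMul,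
      connV_zero_eq_connU_one]
  refine ⟨f, fun q => N q 2, hf, hs.row 2, fun q hq => ?_⟩
  have hent : ∀ i j, mink (N q i) (N q j) = gram (E q) (G q) i j := fun i j => by
    rw [← hgram q hq, mul_lorentz_mul_transpose_apply]
  have hconn : ∀ (M : Matrix (Fin 3) (Fin 3) ℝ) (i j : Fin 3),
      mink ((M * N q) i) (N q j) = (M * gram (E q) (G q)) i j := fun M i j => by
    rw [← mul_lorentz_mul_transpose_apply, mul_assoc, mul_assoc, ← mul_assoc (N q), hgram q hq]
  have huu : pu (pu f) q = _ :=
    (EqOn.pu_eq hU (fun x hx => (hfN x hx).1) hq).trans (hrow q hq 0).1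
  have huv : pv (pu f) q = _ :=
    (EqOn.pv_eq hU (fun x hx => (hfN x hx).1) hq).trans (hrow q hq 0).2
  have hvv : pv (pv f) q = _ :=
    (EqOn.pv_eq hU (fun x hx => (hfN x hx).2) hq).trans (hrow q hq 1).2
  rw [huu, huv, hvv, (hfN q hq).1, (hfN q hq).2]
  simp only [hent, hconn, connU_mul_gram (h0 q hq), connV_mul_gram (h0 q hq)]
  simp [gram]

/-- The Gauss–Codazzi equations are sufficient for the existence of a realization. -/
theorem exists_isRealization {E G X Y Z : ℝ × ℝ → ℝ} {U : Set (ℝ × ℝ)} (hU : IsOpen U)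
    (hc : IsPreconnected U) [SimplyConnectedSpace U]
    (hE : ContDiffOn ℝ (⊤ : ℕ∞) E U) (hG : ContDiffOn ℝ (⊤ : ℕ∞) G U)
    (hX : ContDiffOn ℝ (⊤ : ℕ∞) X U) (hY : ContDiffOn ℝ (⊤ : ℕ∞) Y U)
    (hZ : ContDiffOn ℝ (⊤ : ℕ∞) Z U)
    (hEpos : ∀ q ∈ U, 0 < E q)
    (hC1 : ∀ q ∈ U, pv X q - pu Y q
      = (pv E q * X q - pu E q * Y q) / (2 * E q) + (Y q) ^ 2 - X q * Z q)
    (hC2 : ∀ q ∈ U, pv Y q - pu Z q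
      = -((pu G q * X q + pv E q * Y q) / (2 * E q)))
    (hGauss : ∀ q ∈ U, pv (pv E) q + pu (pu G) q
        - (pu E q * pu G q + (pv E q) ^ 2) / (2 * E q)
      = 2 * G q * (X q * Z q - (Y q) ^ 2)
        - pv G q * X q + 2 * pu G q * Y q + pv E q * Z q) :
    ∃ f ψ : ℝ × ℝ → Fin 3 → ℝ, ContDiffOn ℝ (⊤ : ℕ∞) f U ∧ ContDiffOn ℝ (⊤ : ℕ∞) ψ U ∧
      IsRealization E G X Y Z U f ψ := by
  have : CompleteSpace (Matrix (Fin 3) (Fin 3) ℝ) := FiniteDimensional.complete ℝ _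
  obtain ⟨p, hp⟩ : U.Nonempty := nonempty_coe_sort.1 inferInstance
  have h0 : ∀ q ∈ U, E q ≠ 0 := fun q hq => (hEpos q hq).ne'
  have hA := contDiffOn_connU hE (hE.pu hU) (hE.pv hU) hG (hG.pu hU) hX hY h0
  have hB := contDiffOn_connV hE (hE.pv hU) hG (hG.pu hU) (hG.pv hU) hY hZ h0
  have dE := fun q hq => hE.differentiableAt_of_isOpen hU (q := q) hq
  have dG := fun q hq => hG.differentiableAt_of_isOpen hU (q := q) hq
  obtain ⟨Φ, hΦp, hΦ⟩ := exists_isParallel hU (hA.of_le (by exact_mod_cast le_top))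
    (hB.of_le (by exact_mod_cast le_top))
    (fun q hq => pv_connU_add_mul_eq (dE q hq)
      ((hE.pu hU).differentiableAt_of_isOpen hU hq) ((hE.pv hU).differentiableAt_of_isOpen hU hq)
      (dG q hq) ((hG.pu hU).differentiableAt_of_isOpen hU hq)
      ((hG.pv hU).differentiableAt_of_isOpen hU hq) (hX.differentiableAt_of_isOpen hU hq)
      (hY.differentiableAt_of_isOpen hU hq) (hZ.differentiableAt_of_isOpen hU hq) (h0 q hq)
      rfl rfl rfl rfl (pu_pv_comm hU hE hq).symm (pu_pv_comm hU hG hq).symm (hC1 q hq)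
      (hC2 q hq) (hGauss q hq)) hp
  obtain ⟨C, hC⟩ := exists_mul_lorentz_mul_transpose_eq_gram (hEpos p hp) (G p)
  have hN := hΦ.mul_const C
  refine hN.exists_isRealization hU hc h0 (hN.contDiffOn hU hA hB) fun q hq => ?_
  exact hN.mul_lorentz_mul_transpose (g := fun x => gram (E x) (G x)) hU hc hA.continuousOn
    hB.continuousOn
    (fun q hq => differentiableAt_gram (dE q hq) (dG q hq))
    (fun q hq => pu_gram (dE q hq) (dG q hq) (h0 q hq) _ _ _)
    (fun q hq => pv_gram (dE q hq) (dG q hq) (h0 q hq) _ _ _) hp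
    (by simp only [hΦp, one_mul, hC]) hq

end

end

/-- Fundamental theorem of mixed type surfaces. Given smooth data
`E > 0`, `G` (with a semidefinite point: `G(p) = 0`, `dG(p) ≠ 0`) and `X, Y, Z`
on a connected, simply connected open set `U ⊆ ℝ²` satisfying the Gauss–Codazzi
equations, there exist a smooth immersion `f : U → 𝕃³` and a smooth map
`ψ : U → ℝ³` realizing `E, 0, G` as first fundamental form and `X, Y, Z` as the
second fundamental form associated with the L-Gauss map `ψ`; the pair `(f, ψ)`
is unique up to isometries of `𝕃³`. -/
theorem fundamental_theorem_mixed_type_surfaces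
    (U : Set (ℝ × ℝ)) (hU : IsOpen U) (hconn : IsConnected U)
    (hsc : SimplyConnectedSpace U)
    (E G X Y Z : ℝ × ℝ → ℝ)
    (hE : ContDiffOn ℝ (⊤ : ℕ∞) E U)
    (hG : ContDiffOn ℝ (⊤ : ℕ∞) G U)
    (hX : ContDiffOn ℝ (⊤ : ℕ∞) X U)
    (hY : ContDiffOn ℝ (⊤ : ℕ∞) Y U)
    (hZ : ContDiffOn ℝ (⊤ : ℕ∞) Z U)
    (hEpos : ∀ q ∈ U, 0 < E q)
    (hsemidef : ∃ p ∈ U, G p = 0 ∧ fderiv ℝ G p ≠ 0)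
    (hC1 : ∀ q ∈ U, pv X q - pu Y q
      = (pv E q * X q - pu E q * Y q) / (2 * E q) + (Y q) ^ 2 - X q * Z q)
    (hC2 : ∀ q ∈ U, pv Y q - pu Z q
      = -((pu G q * X q + pv E q * Y q) / (2 * E q)))
    (hGauss : ∀ q ∈ U, pv (pv E) q + pu (pu G) q
        - (pu E q * pu G q + (pv E q) ^ 2) / (2 * E q)
      = 2 * G q * (X q * Z q - (Y q) ^ 2)
        - pv G q * X q + 2 * pu G q * Y q + pv E q * Z q) :
    ∃ (f ψ : ℝ × ℝ → Fin 3 → ℝ),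
      ContDiffOn ℝ (⊤ : ℕ∞) f U ∧ ContDiffOn ℝ (⊤ : ℕ∞) ψ U ∧
      (∀ q ∈ U, LinearIndependent ℝ ![pu f q, pv f q]) ∧
      (∀ q ∈ U,
        mink (pu f q) (pu f q) = E q ∧ mink (pu f q) (pv f q) = 0 ∧
        mink (pv f q) (pv f q) = G q ∧ mink (ψ q) (ψ q) = 0 ∧
        mink (ψ q) (pu f q) = 0 ∧ mink (ψ q) (pv f q) = 1 ∧
        mink (pu (pu f) q) (ψ q) = X q ∧ mink (pv (pu f) q) (ψ q) = Y q ∧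
        mink (pv (pv f) q) (ψ q) = Z q) ∧
      -- uniqueness up to isometries of 𝕃³
      (∀ f' ψ' : ℝ × ℝ → Fin 3 → ℝ,
        ContDiffOn ℝ (⊤ : ℕ∞) f' U → ContDiffOn ℝ (⊤ : ℕ∞) ψ' U →
        (∀ q ∈ U, LinearIndependent ℝ ![pu f' q, pv f' q]) →
        (∀ q ∈ U,
          mink (pu f' q) (pu f' q) = E q ∧ mink (pu f' q) (pv f' q) = 0 ∧
          mink (pv f' q) (pv f' q) = G q ∧ mink (ψ' q) (ψ' q) = 0 ∧
          mink (ψ' q) (pu f' q) = 0 ∧ mink (ψ' q) (pv f' q) = 1 ∧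
          mink (pu (pu f') q) (ψ' q) = X q ∧ mink (pv (pu f') q) (ψ' q) = Y q ∧
          mink (pv (pv f') q) (ψ' q) = Z q) →
        ∃ (A : Matrix (Fin 3) (Fin 3) ℝ) (b : Fin 3 → ℝ),
          A.transpose * !![1, 0, 0; 0, 1, 0; 0, 0, -1] * A
            = !![1, 0, 0; 0, 1, 0; 0, 0, -1] ∧
          ∀ q ∈ U, f' q = A.mulVec (f q) + b ∧ ψ' q = A.mulVec (ψ q)) := by
  have h0 : ∀ q ∈ U, E q ≠ 0 := fun q hq => (hEpos q hq).ne'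
  obtain ⟨f, ψ, hf, hψ, h⟩ :=
    exists_isRealization hU hconn.isPreconnected hE hG hX hY hZ hEpos hC1 hC2 hGauss
  exact ⟨f, ψ, hf, hψ, fun q hq => h.linearIndependent hq (h0 q hq), h,
    fun f' ψ' hf' hψ' _ h' => h.exists_isometry hU hconn hE hG hX hY hZ h0 hf hψ hf' hψ' h'⟩
end
end

section
/- Let f : U → 𝕃³ be a smooth immersion on an open neighborhood U of (0,0) ∈ ℝ² with ⟨f_u, f_v⟩ ≡ 0, E := ⟨f_u, f_u⟩ > 0, G := ⟨f_v, f_v⟩, E(u,0) = 1, G(u,0) = 0, G_v(u,0) ≠ 0 and E_v(u,0) ≠ 0 for all u with (u,0) ∈ U (so the u-axis consists of generic lightlike points of the first kind, in L-coordinates associated with the lightlike set). Let ψ : U → ℝ³ be an L-Gauss map of f with sign ε ∈ {1, −1}, and set ĉ(u) := f(u,0), x(u) := ⟨f_uu, ψ⟩(u,0), y(u) := ⟨f_uv, ψ⟩(u,0), θ(u) := ⟨ĉ''(u), ĉ''(u)⟩. Then: (i) ⟨ĉ'(u), ĉ'(u)⟩ = 1 and ĉ''(u) ≠ 0 (ĉ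 is a unit-speed spacelike curve with non-zero curvature); (ii) θ(u) = −E_v(u,0)·x(u) for all u; (iii) if θ(u) ≠ 0 for all u (ĉ is a Frenet curve), then with the torsion τ(u) := −det(ĉ'(u), ĉ''(u), ĉ'''(u))/θ(u) one has y(u) = ε·τ(u) + E_uv(u,0)/E_v(u,0) − θ'(u)/(2θ(u)). -/
noncomputable section

open Filter Topology in
lemma eventually_mem_axis {U : Set (ℝ × ℝ)} (hU : IsOpen U) {u : ℝ} (hu : (u, (0 : ℝ)) ∈ U) :
    ∀ᶠ t in 𝓝 u, (t, (0 : ℝ)) ∈ U :=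
  (Continuous.prodMk_left (0 : ℝ)).continuousAt.eventually (hU.mem_nhds hu)

section PartialDerivatives

variable {V : Type*} [NormedAddCommGroup V] [NormedSpace ℝ V]

lemma contDiffAt_pu {g : ℝ × ℝ → V} {q : ℝ × ℝ} (hg : ContDiffAt ℝ (⊤ : ℕ∞) g q) :
    ContDiffAt ℝ (⊤ : ℕ∞) (pu g) q :=
  (hg.fderiv_right (m := (⊤ : ℕ∞)) (by simp)).clm_apply contDiffAt_const

lemma contDiffAt_pv {g : ℝ × ℝ → V} {q : ℝ × ℝ} (hg : ContDiffAt ℝ (⊤ : ℕ∞) g q) :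
    ContDiffAt ℝ (⊤ : ℕ∞) (pv g) q :=
  (hg.fderiv_right (m := (⊤ : ℕ∞)) (by simp)).clm_apply contDiffAt_const

lemma pv_pu_eq_pu_pv {g : ℝ × ℝ → V} {q : ℝ × ℝ} (hg : ContDiffAt ℝ (⊤ : ℕ∞) g q) :
    pv (pu g) q = pu (pv g) q := by
  have hd : DifferentiableAt ℝ (fderiv ℝ g) q :=
    (hg.fderiv_right (m := (⊤ : ℕ∞)) (by simp)).differentiableAt (by simp)
  have hs : IsSymmSndFDerivAt ℝ g q :=
    hg.isSymmSndFDerivAt (by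
      rw [minSmoothness_of_isRCLikeNormedField]; exact WithTop.coe_le_coe.2 le_top)
  have h (w z : ℝ × ℝ) :
      fderiv ℝ (fun p => fderiv ℝ g p w) q z = fderiv ℝ (fderiv ℝ g) q z w := by
    rw [fderiv_clm_apply hd (differentiableAt_const w)]
    simp
  change fderiv ℝ (fun p => fderiv ℝ g p (1, 0)) q (0, 1)
    = fderiv ℝ (fun p => fderiv ℝ g p (0, 1)) q (1, 0)
  rw [h, h]
  exact hs _ _

lemma hasDerivAt_axis {g : ℝ × ℝ → V} {u : ℝ} (hg : DifferentiableAt ℝ g (u, 0)) :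
    HasDerivAt (fun t => g (t, 0)) (pu g (u, 0)) u :=
  hg.hasFDerivAt.comp_hasDerivAt u ((hasDerivAt_id u).prodMk (hasDerivAt_const u (0 : ℝ)))

lemma pu_axis_eq_zero {U : Set (ℝ × ℝ)} (hU : IsOpen U) {g : ℝ × ℝ → V} {k : V}
    (hk : ∀ t : ℝ, (t, 0) ∈ U → g (t, 0) = k) {u : ℝ} (hu : (u, 0) ∈ U)
    (hg : DifferentiableAt ℝ g (u, 0)) : pu g (u, 0) = 0 := by
  refine (hasDerivAt_axis hg).unique
    ((hasDerivAt_const u k).congr_of_eventuallyEq ?_)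
  filter_upwards [eventually_mem_axis hU hu] with t ht using hk t ht

lemma pu_congr {U : Set (ℝ × ℝ)} (hU : IsOpen U) {g h : ℝ × ℝ → V} (hgh : ∀ q ∈ U, g q = h q)
    {q : ℝ × ℝ} (hq : q ∈ U) : pu g q = pu h q := by
  have : g =ᶠ[nhds q] h := by
    filter_upwards [hU.mem_nhds hq] with p hp using hgh p hp
  simp only [pu, this.fderiv_eq]

end PartialDerivatives

section Mink

lemma mink_comm_s13 (v w : Fin 3 → ℝ) : mink v w = mink w v := by
  simp only [mink]; ring

lemma contDiffAt_mink {a b : ℝ × ℝ → Fin 3 → ℝ} {q : ℝ × ℝ}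
    (ha : ContDiffAt ℝ (⊤ : ℕ∞) a q) (hb : ContDiffAt ℝ (⊤ : ℕ∞) b q) :
    ContDiffAt ℝ (⊤ : ℕ∞) (fun p => mink (a p) (b p)) q := by
  rw [contDiffAt_pi] at ha hb
  exact (((ha 0).mul (hb 0)).add ((ha 1).mul (hb 1))).sub ((ha 2).mul (hb 2))

lemma fderiv_mink {a b : ℝ × ℝ → Fin 3 → ℝ} {q : ℝ × ℝ}
    (ha : DifferentiableAt ℝ a q) (hb : DifferentiableAt ℝ b q) (w : ℝ × ℝ) :
    fderiv ℝ (fun p => mink (a p) (b p)) q w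
      = mink (fderiv ℝ a q w) (b q) + mink (a q) (fderiv ℝ b q w) := by
  have ha' := hasFDerivAt_pi'.1 ha.hasFDerivAt
  have hb' := hasFDerivAt_pi'.1 hb.hasFDerivAt
  have h := (((ha' 0).mul (hb' 0)).add ((ha' 1).mul (hb' 1))).sub ((ha' 2).mul (hb' 2))
  have e : fderiv ℝ (fun p => mink (a p) (b p)) q = _ := h.fderiv
  rw [e]
  simp [mink]
  ring

/-- Expansion in a frame whose Gram matrix is that of a unit vector and a normalized null pair. -/
lemma eq_null_frame_expansion {e l n : Fin 3 → ℝ} (hee : mink e e = 1) (hel : mink e l = 0)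
    (hen : mink n e = 0) (hll : mink l l = 0) (hnn : mink n n = 0) (hnl : mink n l = 1)
    (hD : Matrix.det (Matrix.of ![e, l, n]) ≠ 0) (v : Fin 3 → ℝ) :
    v = mink v e • e + mink v n • l + mink v l • n := by
  set z : Fin 3 → ℝ := v - (mink v e • e + mink v n • l + mink v l • n) with hz
  have hlin (w : Fin 3 → ℝ) : mink z w
      = mink v w - mink v e * mink e w - mink v n * mink l w - mink v l * mink n w := by
    simp only [hz, mink, Pi.sub_apply, Pi.add_apply, Pi.smul_apply, smul_eq_mul]; ring
  have h1 : mink z e = 0 := by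
    rw [hlin, hee, mink_comm_s13 l e, hel, hen]; ring
  have h2 : mink z l = 0 := by
    rw [hlin, hll, hel, hnl]; ring
  have h3 : mink z n = 0 := by
    rw [hlin, hnn, mink_comm_s13 e n, hen, mink_comm_s13 l n, hnl]; ring
  have key : (Matrix.of ![e, l, n]).mulVec ![z 0, z 1, -z 2] = 0 := by
    simp only [mink] at h1 h2 h3
    ext i
    fin_cases i <;> simp [Matrix.mulVec, dotProduct, Fin.sum_univ_three] <;> linarith
  have hz0 := Matrix.eq_zero_of_mulVec_eq_zero hD key
  have : z = 0 := by
    ext i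
    have := congrFun hz0 i
    fin_cases i <;> simpa using this
  exact sub_eq_zero.1 this

lemma det_eq_mink_lcross (v w z : Fin 3 → ℝ) :
    Matrix.det (Matrix.of ![v, w, z]) = mink (lcross v w) z := by
  simp [Matrix.det_fin_three, mink, lcross]; ring

lemma det_frame_combination (e l n : Fin 3 → ℝ) (x h p q r : ℝ) :
    Matrix.det (Matrix.of ![e, x • l + h • n, p • e + q • l + r • n])
      = (x * r - h * q) * Matrix.det (Matrix.of ![e, l, n]) := by
  simp [Matrix.det_fin_three]; ring

end Mink

/-- Along the lightlike set of generic lightlike points of the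
first kind (in L-coordinates with `E(u,0) = 1`, `G(u,0) = 0`, `G_v(u,0) ≠ 0`,
`E_v(u,0) ≠ 0`), the curve `ĉ(u) = f(u,0)` is a unit-speed spacelike curve with
non-zero curvature; the causal curvature satisfies `θ = −E_v·x`; and if `ĉ` is a
Frenet curve (`θ ≠ 0`), then with the torsion
`τ = −det(ĉ', ĉ'', ĉ''')/θ`, one has `y = ε·τ + E_uv/E_v − θ'/(2θ)`. -/
theorem invariants_first_kind
    (U : Set (ℝ × ℝ)) (hU : IsOpen U) (h00 : (0, 0) ∈ U)
    (f : ℝ × ℝ → Fin 3 → ℝ) (hf : ContDiffOn ℝ (⊤ : ℕ∞) f U)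
    (himm : ∀ q ∈ U, LinearIndependent ℝ ![pu f q, pv f q])
    (E G : ℝ × ℝ → ℝ)
    (hE : E = fun q => mink (pu f q) (pu f q))
    (hG : G = fun q => mink (pv f q) (pv f q))
    (hFzero : ∀ q ∈ U, mink (pu f q) (pv f q) = 0)
    (hEpos : ∀ q ∈ U, 0 < E q)
    (hE1 : ∀ u : ℝ, (u, 0) ∈ U → E (u, 0) = 1)
    (hG0 : ∀ u : ℝ, (u, 0) ∈ U → G (u, 0) = 0)
    (hGv : ∀ u : ℝ, (u, 0) ∈ U → pv G (u, 0) ≠ 0)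
    (hEv : ∀ u : ℝ, (u, 0) ∈ U → pv E (u, 0) ≠ 0)
    (ε : ℝ) (hε : ε = 1 ∨ ε = -1)
    (ψ : ℝ × ℝ → Fin 3 → ℝ) (hψ : ContDiffOn ℝ (⊤ : ℕ∞) ψ U)
    (hLG : ∀ q ∈ U, lcross (pu f q) (pv f q)
      = (ε * Real.sqrt (E q)) • (pv f q - G q • ψ q))
    (hψψ : ∀ q ∈ U, mink (ψ q) (ψ q) = 0)
    (hψu : ∀ q ∈ U, mink (ψ q) (pu f q) = 0)
    (hψv : ∀ q ∈ U, mink (ψ q) (pv f q) = 1)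
    (c : ℝ → Fin 3 → ℝ) (hc : c = fun u => f (u, 0))
    (x y θ : ℝ → ℝ)
    (hx : x = fun u => mink (pu (pu f) (u, 0)) (ψ (u, 0)))
    (hy : y = fun u => mink (pv (pu f) (u, 0)) (ψ (u, 0)))
    (hθ : θ = fun u => mink (deriv (deriv c) u) (deriv (deriv c) u)) :
    -- (i) ĉ is a unit-speed spacelike curve with non-zero curvature
    (∀ u : ℝ, (u, 0) ∈ U →
      mink (deriv c u) (deriv c u) = 1 ∧ deriv (deriv c) u ≠ 0) ∧
    -- (ii) θ = −E_v·x
    (∀ u : ℝ, (u, 0) ∈ U → θ u = -(pv E (u, 0)) * x u) ∧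
    -- (iii) the Frenet case
    ((∀ u : ℝ, (u, 0) ∈ U → θ u ≠ 0) →
      ∀ u : ℝ, (u, 0) ∈ U →
        y u = ε * (-(Matrix.det (Matrix.of
                ![deriv c u, deriv (deriv c) u, deriv (deriv (deriv c)) u])
              / θ u))
          + pv (pu E) (u, 0) / pv E (u, 0)
          - deriv θ u / (2 * θ u)) := by
  have hfA (q) (hq : q ∈ U) : ContDiffAt ℝ (⊤ : ℕ∞) f q := hf.contDiffAt (hU.mem_nhds hq)
  have hne : ((⊤ : ℕ∞) : WithTop ℕ∞) ≠ 0 := by simp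
  have d1 (q) (hq : q ∈ U) := (contDiffAt_pu (hfA q hq)).differentiableAt hne
  have d2 (q) (hq : q ∈ U) := (contDiffAt_pu (contDiffAt_pu (hfA q hq))).differentiableAt hne
  have dv (q) (hq : q ∈ U) := (contDiffAt_pv (hfA q hq)).differentiableAt hne
  have hEA (q) (hq : q ∈ U) : ContDiffAt ℝ (⊤ : ℕ∞) E q :=
    hE ▸ contDiffAt_mink (contDiffAt_pu (hfA q hq)) (contDiffAt_pu (hfA q hq))
  have hGA (q) (hq : q ∈ U) : ContDiffAt ℝ (⊤ : ℕ∞) G q :=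
    hG ▸ contDiffAt_mink (contDiffAt_pv (hfA q hq)) (contDiffAt_pv (hfA q hq))
  -- derivatives of the curve
  have hc1 (u : ℝ) (hu : (u, 0) ∈ U) : deriv c u = pu f (u, 0) :=
    hc ▸ (hasDerivAt_axis ((hfA _ hu).differentiableAt hne)).deriv
  have hc2 (u : ℝ) (hu : (u, 0) ∈ U) : deriv (deriv c) u = pu (pu f) (u, 0) := by
    rw [← (hasDerivAt_axis (d1 _ hu)).deriv]
    exact Filter.EventuallyEq.deriv_eq
      ((eventually_mem_axis hU hu).mono fun t ht => hc1 t ht)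
  have hc3 (u : ℝ) (hu : (u, 0) ∈ U) :
      deriv (deriv (deriv c)) u = pu (pu (pu f)) (u, 0) := by
    rw [← (hasDerivAt_axis (d2 _ hu)).deriv]
    exact Filter.EventuallyEq.deriv_eq
      ((eventually_mem_axis hU hu).mono fun t ht => hc2 t ht)
  have hθu (u : ℝ) (hu : (u, 0) ∈ U) :
      θ u = mink (pu (pu f) (u, 0)) (pu (pu f) (u, 0)) := by
    simp only [hθ, hc2 u hu]
  have hθ' (u : ℝ) (hu : (u, 0) ∈ U) :
      deriv θ u = 2 * mink (pu (pu (pu f)) (u, 0)) (pu (pu f) (u, 0)) := by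
    have h2 := contDiffAt_pu (contDiffAt_pu (hfA _ hu))
    have h : θ =ᶠ[nhds u] fun t => (fun q => mink (pu (pu f) q) (pu (pu f) q)) (t, 0) :=
      (eventually_mem_axis hU hu).mono fun t ht => hθu t ht
    rw [h.deriv_eq, (hasDerivAt_axis ((contDiffAt_mink h2 h2).differentiableAt hne)).deriv]
    refine (fderiv_mink (d2 _ hu) (d2 _ hu) (1, 0)).trans ?_
    rw [mink_comm_s13 (pu (pu f) (u, 0)), two_mul]
    rfl
  -- derivatives of the first fundamental form
  have hEvU (q) (hq : q ∈ U) : pv E q = -2 * mink (pu (pu f) q) (pv f q) := by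
    have h1 : pv E q = mink (pv (pu f) q) (pu f q) + mink (pu f q) (pv (pu f) q) :=
      hE ▸ fderiv_mink (d1 q hq) (d1 q hq) (0, 1)
    have h2 : pu (fun p => mink (pu f p) (pv f p)) q
        = mink (pu (pu f) q) (pv f q) + mink (pu f q) (pu (pv f) q) :=
      fderiv_mink (d1 q hq) (dv q hq) (1, 0)
    rw [pu_congr hU hFzero hq] at h2
    have h3 : pu (fun _ : ℝ × ℝ => (0 : ℝ)) q = 0 := by simp [pu]
    rw [h3] at h2
    rw [h1, mink_comm_s13 (pv (pu f) q), pv_pu_eq_pu_pv (hfA q hq)]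
    linarith
  have hEuv (q) (hq : q ∈ U) : pv (pu E) q
      = -2 * (mink (pu (pu (pu f)) q) (pv f q) + mink (pu (pu f) q) (pv (pu f) q)) := by
    have hd := (contDiffAt_mink (contDiffAt_pu (contDiffAt_pu (hfA q hq)))
      (contDiffAt_pv (hfA q hq))).differentiableAt hne
    rw [pv_pu_eq_pu_pv (hEA q hq), pu_congr hU hEvU hq, pv_pu_eq_pu_pv (hfA q hq)]
    have h1 : pu (fun p => mink (pu (pu f) p) (pv f p)) q
        = mink (pu (pu (pu f)) q) (pv f q) + mink (pu (pu f) q) (pu (pv f) q) :=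
      fderiv_mink (d2 q hq) (dv q hq) (1, 0)
    rw [← h1]
    exact congrArg (fun T : ℝ × ℝ →L[ℝ] ℝ => T (1, 0)) (fderiv_const_mul hd (-2))
  have h21 (u : ℝ) (hu : (u, 0) ∈ U) : mink (pu (pu f) (u, 0)) (pu f (u, 0)) = 0 := by
    have h0 := pu_axis_eq_zero hU hE1 hu ((hEA _ hu).differentiableAt hne)
    have h1 : pu E (u, 0) = mink (pu (pu f) (u, 0)) (pu f (u, 0))
        + mink (pu f (u, 0)) (pu (pu f) (u, 0)) :=
      hE ▸ fderiv_mink (d1 _ hu) (d1 _ hu) (1, 0)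
    rw [h0, mink_comm_s13 (pu f (u, 0))] at h1
    linarith
  have hLL' (u : ℝ) (hu : (u, 0) ∈ U) : mink (pv (pu f) (u, 0)) (pv f (u, 0)) = 0 := by
    have h0 := pu_axis_eq_zero hU hG0 hu ((hGA _ hu).differentiableAt hne)
    have h1 : pu G (u, 0) = mink (pu (pv f) (u, 0)) (pv f (u, 0))
        + mink (pv f (u, 0)) (pu (pv f) (u, 0)) :=
      hG ▸ fderiv_mink (dv _ hu) (dv _ hu) (1, 0)
    rw [h0, mink_comm_s13 (pv f (u, 0)), ← pv_pu_eq_pu_pv (hfA _ hu)] at h1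
    linarith
  -- the null frame along the curve
  have hee (u : ℝ) (hu : (u, 0) ∈ U) : mink (pu f (u, 0)) (pu f (u, 0)) = 1 := by
    simpa only [hE] using hE1 u hu
  have hll (u : ℝ) (hu : (u, 0) ∈ U) : mink (pv f (u, 0)) (pv f (u, 0)) = 0 := by
    simpa only [hG] using hG0 u hu
  have hdet (u : ℝ) (hu : (u, 0) ∈ U) :
      Matrix.det (Matrix.of ![pu f (u, 0), pv f (u, 0), ψ (u, 0)]) = ε := by
    have h := hψv _ hu
    rw [det_eq_mink_lcross, hLG _ hu, hE1 u hu, hG0 u hu]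
    simp only [mink, Real.sqrt_one, mul_one, zero_smul, sub_zero, Pi.smul_apply,
      smul_eq_mul] at h ⊢
    linear_combination ε * h
  have hε0 : ε ≠ 0 := by rcases hε with h | h <;> simp [h]
  have hexp (u : ℝ) (hu : (u, 0) ∈ U) :=
    eq_null_frame_expansion (hee u hu) (hFzero _ hu) (hψu _ hu) (hll u hu) (hψψ _ hu)
      (hψv _ hu) ((hdet u hu).symm ▸ hε0)
  have hc2exp (u : ℝ) (hu : (u, 0) ∈ U) : pu (pu f) (u, 0)
      = x u • pv f (u, 0) + mink (pu (pu f) (u, 0)) (pv f (u, 0)) • ψ (u, 0) := by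
    have h := hexp u hu (pu (pu f) (u, 0))
    rwa [h21 u hu, zero_smul, zero_add, ← congrFun hx u] at h
  have hpair (u : ℝ) (hu : (u, 0) ∈ U) (w : Fin 3 → ℝ) : mink w (pu (pu f) (u, 0))
      = x u * mink w (pv f (u, 0))
        + mink (pu (pu f) (u, 0)) (pv f (u, 0)) * mink w (ψ (u, 0)) := by
    conv_lhs => rw [hc2exp u hu]
    simp only [mink, Pi.add_apply, Pi.smul_apply, smul_eq_mul]
    ring
  have hxu (u : ℝ) : x u = mink (pu (pu f) (u, 0)) (ψ (u, 0)) := congrFun hx u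
  have hyu (u : ℝ) : y u = mink (pv (pu f) (u, 0)) (ψ (u, 0)) := congrFun hy u
  refine ⟨fun u hu => ⟨?_, ?_⟩, fun u hu => ?_, fun hθ0 u hu => ?_⟩
  · rw [hc1 u hu, hee u hu]
  · rw [hc2 u hu]
    intro h0
    apply hEv u hu
    rw [hEvU _ hu, h0]
    simp [mink]
  · rw [hθu u hu, hpair u hu, hEvU _ hu, ← hxu]
    ring
  · have hθ1 := hθ0 u hu
    have hEv1 := hEv u hu
    have hD : Matrix.det (Matrix.of
        ![deriv c u, deriv (deriv c) u, deriv (deriv (deriv c)) u])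
        = (x u * mink (pu (pu (pu f)) (u, 0)) (pv f (u, 0))
          - mink (pu (pu f) (u, 0)) (pv f (u, 0))
            * mink (pu (pu (pu f)) (u, 0)) (ψ (u, 0))) * ε := by
      rw [hc1 u hu, hc2 u hu, hc3 u hu, ← hdet u hu, ← det_frame_combination,
        ← hc2exp u hu, ← hexp u hu]
    have hεε : ε * ε = 1 := by rcases hε with h | h <;> simp [h]
    have hθv : θ u = 2 * x u * mink (pu (pu f) (u, 0)) (pv f (u, 0)) := by
      rw [hθu u hu, hpair u hu, ← hxu]
      ring
    rw [hD, hθ' u hu, hpair u hu, hEuv _ hu, mink_comm_s13 (pu (pu f) (u, 0)) (pv (pu f) (u, 0)),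
      hpair u hu (pv (pu f) (u, 0)), hLL' u hu, ← hyu, hEvU _ hu, hθv]
    rw [hθv] at hθ1
    rw [hEvU _ hu] at hEv1
    generalize mink (pu (pu f) (u, 0)) (pv f (u, 0)) = h at *
    generalize mink (pu (pu (pu f)) (u, 0)) (pv f (u, 0)) = r at *
    generalize mink (pu (pu (pu f)) (u, 0)) (ψ (u, 0)) = q at *
    have hx0 : x u ≠ 0 := by rintro h0; simp [h0] at hθ1
    have hh0 : h ≠ 0 := by rintro h0; simp [h0] at hθ1
    field_simp
    linear_combination (x u * r - h * q) * hεε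
end
end
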